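/- For every μ ∈ P̂_c, the affine Macdonald spherical function Φ_{ξ_μ} := 𝒥φ_{ξ_μ} ∈ 𝒞(P) is invariant under the full affine Weyl group: wΦ_{ξ_μ} = Φ_{ξ_μ} for every w ∈ W. Equivalently, Φ_{ξ_μ} is W₀-invariant and periodic with respect to translations over the lattice cQ̂^∨, where Q̂^∨ is the coroot lattice of R̂₀. -/

import Mathlib

noncomputable section

open scoped RealInnerProductSpace BigOperators Classical
open Filter

namespace AffinePieri

variable {V : Type*} [NormedAddCommGroup V] [InnerProductSpace ℝ V] [FiniteDimensional ℝ V]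

/-- The coroot `α^∨ = 2α/⟨α,α⟩` of a vector `α`. -/
def coroot (α : V) : V := (2 / ⟪α, α⟫) • α

lemma refl_involutive (α : V) (k : ℝ) :
    Function.Involutive (fun x : V => x - (⟪x, coroot α⟫ + k) • α) := by
  intro x
  by_cases h : α = 0
  · simp [h, coroot]
  · have hαα : ⟪α, α⟫ ≠ 0 := fun hc => h (inner_self_eq_zero.mp hc)
    have h2 : ⟪α, coroot α⟫ = 2 := by
      rw [coroot, real_inner_smul_right]
      field_simp
    show (x - (⟪x, coroot α⟫ + k) • α) -
        (⟪x - (⟪x, coroot α⟫ + k) • α, coroot α⟫ + k) • α = x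
    rw [inner_sub_left, real_inner_smul_left, h2]
    have key : (⟪x, coroot α⟫ + k) +
        (⟪x, coroot α⟫ - (⟪x, coroot α⟫ + k) * 2 + k) = 0 := by ring
    rw [sub_sub, ← add_smul, key, zero_smul, sub_zero]

/-- The (affine) orthogonal reflection `x ↦ x - (⟨x,α^∨⟩ + k)α` as a permutation of `V`. -/
def reflP (α : V) (k : ℝ) : Equiv.Perm V :=
  Function.Involutive.toPerm _ (refl_involutive α k)

@[simp] lemma reflP_apply (α : V) (k : ℝ) (x : V) :
    reflP α k x = x - (⟪x, coroot α⟫ + k) • α := rfl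

/-- The sign of a real number, as an integer. -/
def zsgn (v : ℝ) : ℤ := if 0 < v then 1 else if v < 0 then -1 else 0

/-- Alternating composition `f ∘ g ∘ f ∘ ⋯` with `m` factors, used for braid relations. -/
def altOp {A : Type*} (f g : A → A) : ℕ → A → A
  | 0 => id
  | (k + 1) => f ∘ altOp g f k

/-- The interaction potential `v_α` entering the Morse (fusion) potential, for a
parameter family `s`. -/
def vintOf (s : V → ℝ) (α : V) (x : ℝ) : ℝ :=
  (1 - s α ^ 2) * ∫ y in (0:ℝ)..x, 1 / (1 - 2 * s α * Real.cos y + s α ^ 2)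

/-- All the standing data of the paper: an irreducible reduced crystallographic root
system `R₀` spanning the Euclidean space `V`, with a positive system, simple roots,
highest (short) roots, an admissible pair `(R₀, R̂₀)` encoded by the map `hat` and the
affine root `α₀`, a `W₀`-invariant multiplicity function `t` with values in `(-1,1)`,
and an integral level `c > 1`. -/
structure Setup (V : Type*) [NormedAddCommGroup V] [InnerProductSpace ℝ V]
    [FiniteDimensional ℝ V] where
  n : ℕ
  npos : 0 < n
  hdim : Module.finrank ℝ V = n
  R0 : Finset V
  zero_not_mem : (0 : V) ∉ R0
  span_top : Submodule.span ℝ (R0 : Set V) = ⊤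
  cryst : ∀ α ∈ R0, ∀ β ∈ R0, ∃ k : ℤ, ⟪β, coroot α⟫ = (k : ℝ)
  refl_mem : ∀ α ∈ R0, ∀ β ∈ R0, β - ⟪β, coroot α⟫ • α ∈ R0
  reduced : ∀ α ∈ R0, ∀ r : ℝ, r • α ∈ R0 → r = 1 ∨ r = -1
  irred : ¬ ∃ A B : Set V, A.Nonempty ∧ B.Nonempty ∧ A ∪ B = (R0 : Set V) ∧
      ∀ α ∈ A, ∀ β ∈ B, ⟪α, β⟫ = 0
  Rpos : Finset V
  pos_subset : Rpos ⊆ R0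
  pos_partition : ∀ α ∈ R0, (α ∈ Rpos ↔ -α ∉ Rpos)
  simple : Fin n → V
  simple_mem : ∀ j, simple j ∈ Rpos
  pos_decomp : ∀ α ∈ Rpos, ∃ f : Fin n → ℕ, α = ∑ j, (f j : ℝ) • simple j
  hroot : V
  hroot_mem : hroot ∈ Rpos
  hroot_highest : ∀ β ∈ R0, ∃ f : Fin n → ℕ, hroot - β = ∑ j, (f j : ℝ) • simple j
  hs : V
  hs_mem : hs ∈ Rpos
  hs_short : ∀ α ∈ R0, ⟪hs, hs⟫ ≤ ⟪α, α⟫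
  hs_highest : ∀ β ∈ R0, ⟪β, β⟫ = ⟪hs, hs⟫ →
      ∃ f : Fin n → ℕ, hs - β = ∑ j, (f j : ℝ) • simple j
  hat : V → V
  a0 : V
  admissible : ((∀ α : V, hat α = coroot α) ∧ a0 = -hs) ∨
      ((∀ α : V, hat α = (2 / ⟪hroot, hroot⟫) • α) ∧ a0 = -hroot)
  t : V → ℝ
  t_bound : ∀ α ∈ R0, |t α| < 1
  t_invariant : ∀ α ∈ R0, ∀ β ∈ R0, t (β - ⟪β, coroot α⟫ • α) = t β
  c : ℤ
  c_gt : 1 < c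

namespace Setup

variable (S : Setup V)

/-- `m_α = 2/⟨α, α̂⟩`. -/
def m (α : V) : ℝ := 2 / ⟪α, S.hat α⟫

/-- The finite Weyl group `W₀`, generated by the reflections in the roots. -/
def W0 : Subgroup (Equiv.Perm V) :=
  Subgroup.closure {w | ∃ α ∈ S.R0, w = reflP α 0}

/-- The affine Weyl group `W`, generated by the affine reflections
`s_a` for `a = α^∨ + m_α r c`. -/
def W : Subgroup (Equiv.Perm V) :=
  Subgroup.closure {w | ∃ α ∈ S.R0, ∃ r : ℤ, w = reflP α (S.m α * (r : ℝ) * (S.c : ℝ))}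

/-- The `W₀`-orbit of a vector. -/
def orb (ω : V) : Set V := {x | ∃ w ∈ S.W0, w ω = x}

/-- The weight lattice `P` of `R₀`. -/
def Plat : Set V := {x | ∀ α ∈ S.R0, ∃ k : ℤ, ⟪x, coroot α⟫ = (k : ℝ)}

/-- The root lattice `Q` of `R₀`. -/
def Qlat : Set V := (AddSubgroup.closure (S.R0 : Set V) : Set V)

/-- The semigroup `Q⁺` generated by the positive roots. -/
def Qplus : Set V := (AddSubmonoid.closure (S.Rpos : Set V) : Set V)

/-- The cone `P⁺` of dominant weights. -/
def Pplus : Set V := {x | x ∈ S.Plat ∧ ∀ α ∈ S.Rpos, 0 ≤ ⟪x, coroot α⟫}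

/-- The dominant affine alcove `A_c = {x | 0 ≤ ⟨x,β⟩ ≤ c ∀ β ∈ R̂₀⁺}`. -/
def Alc : Set V := {x | ∀ α ∈ S.Rpos, 0 ≤ ⟪x, S.hat α⟫ ∧ ⟪x, S.hat α⟫ ≤ (S.c : ℝ)}

/-- `P_c = P ∩ A_c`. -/
def Pc : Set V := {x | x ∈ S.Plat ∧ x ∈ S.Alc}

/-- The weight lattice `P̂` of `R̂₀`. -/
def Phat : Set V := {x | ∀ α ∈ S.R0, ∃ k : ℤ, ⟪x, coroot (S.hat α)⟫ = (k : ℝ)}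

/-- `P̂_c = {μ ∈ P̂ | 0 ≤ ⟨μ,α⟩ ≤ c ∀ α ∈ R₀⁺}`. -/
def Phatc : Set V :=
  {x | x ∈ S.Phat ∧ ∀ α ∈ S.Rpos, 0 ≤ ⟪x, α⟫ ∧ ⟪x, α⟫ ≤ (S.c : ℝ)}

/-- The half sum `ρ` of the positive roots of `R₀`. -/
def rho : V := (2⁻¹ : ℝ) • ∑ α ∈ S.Rpos, α

/-- The half sum `ρ̂` of the positive roots of `R̂₀`. -/
def rhoHat : V := (2⁻¹ : ℝ) • ∑ α ∈ S.Rpos, S.hat α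

/-- The coroot lattice `Q̂^∨` of `R̂₀`. -/
def Qhatvee : Set V :=
  (AddSubgroup.closure ((fun α => coroot (S.hat α)) '' (S.R0 : Set V)) : Set V)

/-- The gradient (direction) of the affine simple root `a_j`:
`α₀` for `j = 0` and `α_j` otherwise. -/
def alpha (j : Fin (S.n + 1)) : V :=
  if h : (j : ℕ) = 0 then S.a0 else S.simple ⟨(j : ℕ) - 1, by have := j.isLt; omega⟩

/-- The constant term of the affine simple root `a_j`. -/
def kconst (j : Fin (S.n + 1)) : ℝ := if (j : ℕ) = 0 then (S.c : ℝ) else 0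

/-- The affine simple root `a_j` as an affine function on `V`. -/
def aFun (j : Fin (S.n + 1)) (x : V) : ℝ := ⟪x, coroot (S.alpha j)⟫ + S.kconst j

/-- The simple affine reflections `s_0, s_1, …, s_n`. -/
def sgen (j : Fin (S.n + 1)) : Equiv.Perm V := reflP (S.alpha j) (S.kconst j)

/-- The length of an element of the affine Weyl group: the minimal length of an
expression as a product of the simple reflections. -/
def len (w : Equiv.Perm V) : ℕ :=
  sInf {k | ∃ l : List (Fin (S.n + 1)), l.length = k ∧ (l.map S.sgen).prod = w}

/-- The length of an element of the finite Weyl group w.r.t. the simple reflections. -/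
def len0 (w : Equiv.Perm V) : ℕ :=
  sInf {k | ∃ l : List (Fin S.n), l.length = k ∧
    (l.map fun j => reflP (S.simple j) 0).prod = w}

/-- `l` is a reduced expression for `w`. -/
def IsReducedWord (l : List (Fin (S.n + 1))) (w : Equiv.Perm V) : Prop :=
  (l.map S.sgen).prod = w ∧ l.length = S.len w

/-- The Bruhat partial order on the affine Weyl group. -/
def BruhatLE (v w : Equiv.Perm V) : Prop :=
  ∃ l : List (Fin (S.n + 1)), S.IsReducedWord l w ∧
    ∃ l' : List (Fin (S.n + 1)), l'.Sublist l ∧ (l'.map S.sgen).prod = v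

/-- Evaluation of a function on the weight lattice at a point of `V` (by `0` off `P`). -/
def ev (f : ↥S.Plat → ℂ) (x : V) : ℂ := if h : x ∈ S.Plat then f ⟨x, h⟩ else 0

/-- The integral part `J_j` of the integral-reflection operators. -/
def Jop (j : Fin (S.n + 1)) (f : ↥S.Plat → ℂ) (x : ↥S.Plat) : ℂ :=
  if 0 < Int.floor (S.aFun j x.1) then
    -∑ k ∈ Finset.Icc (1 : ℤ) (Int.floor (S.aFun j x.1)),
      S.ev f (x.1 - (k : ℝ) • S.alpha j)
  else if Int.floor (S.aFun j x.1) < 0 then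
    ∑ k ∈ Finset.Icc (0 : ℤ) (-(Int.floor (S.aFun j x.1)) - 1),
      S.ev f (x.1 + (k : ℝ) • S.alpha j)
  else 0

/-- The integral-reflection operators `T_j = t_j s_j + (t_j - 1) J_j` on `𝒞(P)`. -/
def Top (j : Fin (S.n + 1)) (f : ↥S.Plat → ℂ) (x : ↥S.Plat) : ℂ :=
  (S.t (S.alpha j) : ℂ) * S.ev f ((S.sgen j)⁻¹ x.1) +
    ((S.t (S.alpha j) : ℂ) - 1) * S.Jop j f x

/-- The operator `T_{j₁} ∘ ⋯ ∘ T_{j_ℓ}` attached to a word `l = [j₁, …, j_ℓ]`. -/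
def wordOp (l : List (Fin (S.n + 1))) : (↥S.Plat → ℂ) → (↥S.Plat → ℂ) :=
  l.foldr (fun j g => S.Top j ∘ g) id

/-- `TW` realizes `w ↦ T_w` (via reduced expressions). -/
def IsTW (TW : Equiv.Perm V → (↥S.Plat → ℂ) → (↥S.Plat → ℂ)) : Prop :=
  ∀ w l, S.IsReducedWord l w → TW w = S.wordOp l

/-- `tw` realizes the length multiplicative function `w ↦ t_w` (via reduced expressions). -/
def IsTmult (tw : Equiv.Perm V → ℂ) : Prop :=
  ∀ w l, S.IsReducedWord l w → tw w = (l.map fun j => (S.t (S.alpha j) : ℂ)).prod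

/-- `wmin` realizes `x ↦ w_x`, the unique shortest affine Weyl group element moving `x`
into the dominant alcove. -/
def IsShortest (wmin : V → Equiv.Perm V) : Prop :=
  ∀ x : V, wmin x ∈ S.W ∧ wmin x x ∈ S.Alc ∧
    ∀ w ∈ S.W, w x ∈ S.Alc →
      S.len (wmin x) ≤ S.len w ∧ (S.len w = S.len (wmin x) → w = wmin x)

/-- The positive affine roots, encoded as pairs `(α, r)` representing `α^∨ + m_α r c`. -/
def RplusP : Set (V × ℤ) :=
  {p | p.1 ∈ S.R0 ∧ (1 ≤ p.2 ∨ (p.2 = 0 ∧ p.1 ∈ S.Rpos))}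

/-- The value of the affine root encoded by `p = (α, r)` at a point of `V`. -/
def affval (p : V × ℤ) (x : V) : ℝ :=
  ⟪x, coroot p.1⟫ + S.m p.1 * (p.2 : ℝ) * (S.c : ℝ)

/-- `R[λ] = {a ∈ R⁺ | a(λ) < 0}`. -/
def Raff (lam : V) : Set (V × ℤ) := {p | p ∈ S.RplusP ∧ S.affval p lam < 0}

/-- `t[λ] = ∏_{a ∈ R[λ]} t_{a'}`. -/
def tBr (lam : V) : ℂ := ∏ᶠ p ∈ S.Raff lam, (S.t p.1 : ℂ)

/-- `θ(λ) = |{a ∈ R⁺ | a(λ) = -2}|`. -/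
def thetaCt (lam : V) : ℕ :=
  Set.ncard {p : V × ℤ | p ∈ S.RplusP ∧ S.affval p lam = -2}

/-- The affine intertwining operator `𝒥`, defined via `wmin` and `TW`. -/
def JJ (wmin : V → Equiv.Perm V) (TW : Equiv.Perm V → (↥S.Plat → ℂ) → (↥S.Plat → ℂ))
    (f : ↥S.Plat → ℂ) (x : ↥S.Plat) : ℂ :=
  (S.tBr x.1)⁻¹ * S.ev (TW (wmin x.1) f) (wmin x.1 x.1)

/-- The Morse (fusion-potential) function `𝒱_μ` for a parameter family `s`. -/
def MorseOf (s : V → ℝ) (μ ξ : V) : ℝ :=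
  ((S.c : ℝ) / 2) * ⟪ξ, ξ⟫ - 2 * Real.pi * ⟪S.rhoHat + μ, ξ⟫ +
    ∑ α ∈ S.Rpos, (2 / ⟪α, coroot (S.hat α)⟫) * ∫ x in (0:ℝ)..(⟪ξ, α⟫), vintOf s α x

/-- The Morse function `𝒱_μ` for the multiplicity function of the setup. -/
def Morse (μ ξ : V) : ℝ := S.MorseOf S.t μ ξ

/-- The critical equation `cξ + ∑_{α∈R₀⁺} v_α(⟨ξ,α⟩) α̂ = 2π(ρ̂ + μ)`. -/
def CritEq (μ x : V) : Prop :=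
  (S.c : ℝ) • x + ∑ α ∈ S.Rpos, (vintOf S.t α ⟪x, α⟫) • S.hat α =
    (2 * Real.pi) • (S.rhoHat + μ)

/-- Extension of a parameter vector indexed by `R₀` to a function on `V` (by zero). -/
def extParam (s : ↥S.R0 → ℝ) : V → ℝ := fun α => if h : α ∈ S.R0 then s ⟨α, h⟩ else 0

/-- `xi` realizes `μ ↦ ξ_μ`, the unique global minimizer of `𝒱_μ`. -/
def IsMinimizer (xi : V → V) : Prop :=
  ∀ μ ∈ S.Phat, ∀ x : V, x ≠ xi μ → S.Morse μ (xi μ) < S.Morse μ x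

/-- The `c`-function of the Macdonald spherical function. -/
def Cfun (ξ : V) : ℂ :=
  ∏ α ∈ S.Rpos, (1 - (S.t α : ℂ) * Complex.exp (-(Complex.I * (⟪ξ, α⟫ : ℂ)))) /
      (1 - Complex.exp (-(Complex.I * (⟪ξ, α⟫ : ℂ))))

/-- The Macdonald spherical function `M_λ(ξ)`. -/
def Msph (lam ξ : V) : ℂ :=
  ∑ᶠ w ∈ (S.W0 : Set (Equiv.Perm V)),
    S.Cfun (w ξ) * Complex.exp (Complex.I * (⟪w ξ, lam⟫ : ℂ))

/-- The orbit sum `m_ω(e^{iξ})`. -/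
def mSym (ω ξ : V) : ℂ := ∑ᶠ ν ∈ S.orb ω, Complex.exp (Complex.I * (⟪ν, ξ⟫ : ℂ))

/-- The plane wave `e^{iξ} ∈ 𝒞(P)`. -/
def planewave (ξ : V) : ↥S.Plat → ℂ :=
  fun lam => Complex.exp (Complex.I * (⟪lam.1, ξ⟫ : ℂ))

/-- The free operator `L_{ω;1}`. -/
def Lfree (ω : V) (f : ↥S.Plat → ℂ) (x : ↥S.Plat) : ℂ :=
  ∑ᶠ ν ∈ S.orb ω, S.ev f (x.1 + ν)

/-- `φ_ξ = ∑_{v ∈ W₀} T_v e^{iξ}`. -/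
def phiW (TW : Equiv.Perm V → (↥S.Plat → ℂ) → (↥S.Plat → ℂ)) (ξ : V) : ↥S.Plat → ℂ :=
  ∑ᶠ w ∈ (S.W0 : Set (Equiv.Perm V)), TW w (S.planewave ξ)

/-- The affine Macdonald spherical function `Φ_ξ = 𝒥 φ_ξ`. -/
def PhiA (wmin : V → Equiv.Perm V)
    (TW : Equiv.Perm V → (↥S.Plat → ℂ) → (↥S.Plat → ℂ)) (ξ : V) : ↥S.Plat → ℂ :=
  S.JJ wmin TW (S.phiW TW ξ)

/-- Invariance of a lattice function under the affine Weyl group. -/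
def Winv (f : ↥S.Plat → ℂ) : Prop :=
  ∀ w ∈ S.W, ∀ x : ↥S.Plat, S.ev f (w⁻¹ x.1) = f x

/-- A minuscule dominant weight. -/
def Minuscule (ω : V) : Prop := ω ∈ S.Pplus ∧ ∀ α ∈ S.Rpos, ⟪ω, coroot α⟫ ≤ 1

/-- `P_ϑ^⋆`: the orbit of the minuscule and quasi-minuscule weights. -/
def Pstar : Set V :=
  {x | ∃ w ∈ S.W0, ∃ η : V, (S.Minuscule η ∨ η = S.hs) ∧ x = w η}

/-- `ê_t(η) = ∏_{β∈R̂₀⁺} t_β^{⟨η,β^∨⟩/2}`. -/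
def et (η : V) : ℂ :=
  ∏ α ∈ S.Rpos, (S.t α : ℂ) ^ (((⟪η, coroot (S.hat α)⟫ / 2 : ℝ) : ℂ))

/-- `ĥ_t = t_{α₀} ê_t(-α₀^∨)`. -/
def hhat : ℂ := (S.t S.a0 : ℂ) * S.et (-(coroot S.a0))

/-- `e_t(ν) = ∏_{α∈R₀⁺} t_α^{⟨ν,α^∨⟩/2}`. -/
def elit (ν : V) : ℂ :=
  ∏ α ∈ S.Rpos, (S.t α : ℂ) ^ (((⟪ν, coroot α⟫ / 2 : ℝ) : ℂ))

/-- `h_t = t_ϑ e_t(-α₀)`. -/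
def hlit : ℂ := (S.t S.hs : ℂ) * S.elit (-S.a0)

/-- The coefficients `d_{λ,ν}`. -/
def dcoef (lam ν : V) : ℂ :=
  if ν ∈ S.orb S.hs then
    (S.thetaCt (lam + ν) : ℂ) * S.elit (-ν) * S.hlit ^ zsgn ⟪lam, S.hat ν⟫
  else 0

/-- The Pieri coefficients `V_{λ,ν}(t)`. -/
def Vcoef (lam ν : V) : ℂ :=
  (∏ α ∈ S.Rpos, if ⟪lam, S.hat α⟫ = 0 ∧ 0 < ⟪ν, S.hat α⟫ then
      (1 - (S.t α : ℂ) * S.et (S.hat α)) / (1 - S.et (S.hat α)) else 1) *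
  ∏ α ∈ S.Rpos, if ⟪lam, S.hat α⟫ = (S.c : ℝ) ∧ ⟪ν, S.hat α⟫ < 0 then
      (1 - (S.t α : ℂ) * S.hhat * S.et (-(S.hat α))) / (1 - S.hhat * S.et (-(S.hat α)))
    else 1

/-- The Pieri coefficients `U_{λ,ω}(t)`. -/
def Ucoef (wmin : V → Equiv.Perm V) (lam ω : V) : ℂ :=
  (∑ᶠ ν ∈ {ν | ν ∈ S.orb ω ∧ wmin (lam + ν) (lam + ν) = lam}, S.tBr (lam + ν)) +
    (1 - (S.t S.hs : ℂ)⁻¹) *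
      ∑ᶠ ν ∈ {ν | ν ∈ S.orb ω ∧ wmin (lam + ν) lam = lam}, S.dcoef lam ν

/-- The linear part of an affine transformation of `V`. -/
def linp (w : Equiv.Perm V) (x : V) : V := w x - w (0 : V)

/-- The set `[x] = {y | y₊ = x₊, w_y ≤ w_x}`. -/
def bra (wmin : V → Equiv.Perm V) (x : V) : Set V :=
  {y | wmin y y = wmin x x ∧ S.BruhatLE (wmin y) (wmin x)}

/-- The partial order `μ ⪯ λ`. -/
def preceq (wmin : V → Equiv.Perm V) (μ lam : V) : Prop :=
  lam - μ ∈ S.Qlat ∧ convexHull ℝ (S.bra wmin μ) ⊆ convexHull ℝ (S.bra wmin lam)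

/-- The Weyl denominator `δ(ξ)`. -/
def weylDenom (ξ : V) : ℂ :=
  ∏ α ∈ S.Rpos, (Complex.exp (Complex.I * (⟪ξ, α⟫ : ℂ) / 2) -
      Complex.exp (-(Complex.I * (⟪ξ, α⟫ : ℂ) / 2)))

/-- The Weyl character `χ_λ(ξ)`. -/
def chiW (lam ξ : V) : ℂ :=
  (S.weylDenom ξ)⁻¹ * ∑ᶠ w ∈ (S.W0 : Set (Equiv.Perm V)),
    ((-1 : ℂ) ^ S.len0 w) * Complex.exp (Complex.I * (⟪w ξ, lam + S.rho⟫ : ℂ))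

/-- The counting function `N_{λ,ω}`. -/
def Ncount (lam ω : V) : ℕ :=
  Nat.card {j : Fin (S.n + 1) // S.aFun j lam = 0 ∧ S.alpha j ∈ S.orb ω}

end Setup


namespace Setup

section

/-! ### Reflections -/

/-- The linear reflection. -/
def sr (α : V) : V →ₗ[ℝ] V where
  toFun x := x - ⟪x, coroot α⟫ • α
  map_add' x y := by rw [inner_add_left, add_smul]; abel
  map_smul' r x := by
    rw [real_inner_smul_left, mul_smul, RingHom.id_apply, smul_sub]

lemma sr_apply (α x : V) : sr α x = x - ⟪x, coroot α⟫ • α := rfl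

lemma reflP_eq (α : V) (k : ℝ) (x : V) : reflP α k x = sr α x - k • α := by
  rw [reflP_apply, sr_apply, add_smul]; abel

lemma reflP_zero (α x : V) : reflP α 0 x = sr α x := by rw [reflP_eq]; simp

lemma inner_coroot (x α : V) : ⟪x, coroot α⟫ = 2 * ⟪x, α⟫ / ⟪α, α⟫ := by
  rw [coroot, real_inner_smul_right]; ring

lemma sr_inner_left (α x y : V) : ⟪sr α x, y⟫ = ⟪x, sr α y⟫ := by
  rw [sr_apply, sr_apply, inner_sub_left, inner_sub_right, real_inner_smul_left,
    real_inner_smul_right, inner_coroot, inner_coroot, real_inner_comm y α]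
  ring

lemma sr_sr (α x : V) : sr α (sr α x) = x := by
  have := refl_involutive α 0 x
  simpa [sr_apply] using this

lemma sr_inner (α x y : V) : ⟪sr α x, sr α y⟫ = ⟪x, y⟫ := by
  rw [sr_inner_left, sr_sr]

lemma inner_coroot_self {α : V} (h : α ≠ 0) : ⟪α, coroot α⟫ = 2 := by
  have : ⟪α, α⟫ ≠ 0 := fun hc => h (inner_self_eq_zero.mp hc)
  rw [inner_coroot]; field_simp

lemma sr_self {α : V} (h : α ≠ 0) : sr α α = -α := by
  rw [sr_apply, inner_coroot_self h, two_smul]; abel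

lemma coroot_neg (α : V) : coroot (-α) = -coroot α := by simp [coroot]

lemma coroot_sr (α β : V) : coroot (sr α β) = sr α (coroot β) := by
  rw [coroot, coroot, sr_inner, map_smul]

lemma sr_neg (α : V) : sr (-α) = sr α := by
  ext x; simp [sr_apply, coroot_neg]

lemma sr_conj (α β x : V) : sr (sr β α) x = sr β (sr α (sr β x)) := by
  rw [sr_apply (sr β α), sr_apply α, map_sub, map_smul, sr_sr, coroot_sr, sr_inner_left]

variable (S : Setup V)

lemma ne_zero {α : V} (h : α ∈ S.R0) : α ≠ 0 := fun hc => S.zero_not_mem (hc ▸ h)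

lemma ipos {α : V} (h : α ∈ S.R0) : 0 < ⟪α, α⟫ := by
  rw [real_inner_self_eq_norm_sq]; exact pow_pos (norm_pos_iff.mpr (S.ne_zero h)) 2

lemma sr_mem {α β : V} (h : α ∈ S.R0) (h' : β ∈ S.R0) : sr α β ∈ S.R0 := S.refl_mem α h β h'

lemma neg_mem {α : V} (h : α ∈ S.R0) : -α ∈ S.R0 := by
  rw [← sr_self (S.ne_zero h)]; exact S.sr_mem h h

lemma pos_R {α : V} (h : α ∈ S.Rpos) : α ∈ S.R0 := S.pos_subset h

lemma simple_R (j : Fin S.n) : S.simple j ∈ S.R0 := S.pos_R (S.simple_mem j)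

lemma pos_or_neg {α : V} (h : α ∈ S.R0) : α ∈ S.Rpos ∨ -α ∈ S.Rpos := by
  by_cases hp : α ∈ S.Rpos
  · exact Or.inl hp
  · right; by_contra hn; exact hp ((S.pos_partition α h).mpr hn)

lemma not_neg_pos {α : V} (h : α ∈ S.Rpos) : -α ∉ S.Rpos :=
  (S.pos_partition α (S.pos_R h)).mp h

lemma span_simple : ⊤ ≤ Submodule.span ℝ (Set.range S.simple) := by
  rw [← S.span_top, Submodule.span_le]
  have key : ∀ α ∈ S.Rpos, α ∈ Submodule.span ℝ (Set.range S.simple) := by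
    intro α hα
    obtain ⟨f, rfl⟩ := S.pos_decomp α hα
    exact Submodule.sum_mem _ fun j _ =>
      Submodule.smul_mem _ _ (Submodule.subset_span ⟨j, rfl⟩)
  intro α hα
  rcases S.pos_or_neg hα with h | h
  · exact key α h
  · simpa using Submodule.neg_mem _ (key _ h)

lemma linInd : LinearIndependent ℝ S.simple :=
  linearIndependent_of_top_le_span_of_card_eq_finrank S.span_simple (by simp [S.hdim])

/-- The basis of simple roots. -/
def bas : Module.Basis (Fin S.n) ℝ V := Module.Basis.mk S.linInd S.span_simple

lemma bas_apply (j : Fin S.n) : S.bas j = S.simple j := by simp [bas]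

/-- Coefficients with respect to simple roots. -/
def co (j : Fin S.n) : V →ₗ[ℝ] ℝ := S.bas.coord j

lemma co_simple (i j : Fin S.n) : S.co i (S.simple j) = if j = i then 1 else 0 := by
  rw [← S.bas_apply, co, Module.Basis.coord_apply, Module.Basis.repr_self,
    Finsupp.single_apply]

lemma sum_co (x : V) : ∑ j, S.co j x • S.simple j = x := by
  conv_rhs => rw [← S.bas.sum_repr x]
  simp [co, bas_apply]

lemma co_sum (f : Fin S.n → ℝ) (i : Fin S.n) : S.co i (∑ j, f j • S.simple j) = f i := by
  simp [map_sum, co_simple]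

lemma co_nonneg {α : V} (h : α ∈ S.Rpos) (j : Fin S.n) : 0 ≤ S.co j α := by
  obtain ⟨f, rfl⟩ := S.pos_decomp α h
  rw [S.co_sum (fun j => (f j : ℝ))]; positivity

lemma pos_of_co {α : V} (h : α ∈ S.R0) {j : Fin S.n} (hj : 0 < S.co j α) : α ∈ S.Rpos := by
  rcases S.pos_or_neg h with h | h
  · exact h
  · have := S.co_nonneg h j
    rw [map_neg] at this; linarith

lemma simple_perm {α : V} {j : Fin S.n} (h : α ∈ S.Rpos) (hne : α ≠ S.simple j) :
    sr (S.simple j) α ∈ S.Rpos := by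
  by_cases hz : ∀ i, i ≠ j → S.co i α = 0
  · exfalso
    have h1 : α = S.co j α • S.simple j := by
      conv_lhs => rw [← S.sum_co α]
      rw [Finset.sum_eq_single j]
      · intro i _ hi; rw [hz i hi, zero_smul]
      · simp
    have h2 := S.reduced (S.simple j) (S.simple_R j) (S.co j α) (h1 ▸ S.pos_R h)
    have h3 := S.co_nonneg h j
    rcases h2 with h2 | h2
    · rw [h2, one_smul] at h1; exact hne h1
    · linarith
  · push Not at hz
    obtain ⟨i, hij, hi⟩ := hz
    refine S.pos_of_co (S.sr_mem (S.simple_R j) (S.pos_R h)) (j := i) ?_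
    rw [sr_apply, map_sub, map_smul, co_simple, if_neg (Ne.symm hij)]
    have := S.co_nonneg h i
    simp only [smul_zero, sub_zero]
    exact lt_of_le_of_ne this (Ne.symm hi)

/-- A vector with inner product one with all simple roots. -/
lemma exists_zeta : ∃ ζ : V, ∀ j, ⟪ζ, S.simple j⟫ = 1 := by
  let f : V →ₗ[ℝ] ℝ := ∑ j, S.co j
  refine ⟨(InnerProductSpace.toDual ℝ V).symm (LinearMap.toContinuousLinearMap f), fun j => ?_⟩
  rw [InnerProductSpace.toDual_symm_apply]
  simp [f, co_simple]

/-- The height vector. -/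
def zeta : V := S.exists_zeta.choose

lemma zeta_simple (j : Fin S.n) : ⟪S.zeta, S.simple j⟫ = 1 := S.exists_zeta.choose_spec j

/-- Dominant vectors. -/
def Dom (x : V) : Prop := ∀ j, 0 ≤ ⟪x, S.simple j⟫

lemma inner_eq_sum (x y : V) : ⟪x, y⟫ = ∑ j, S.co j y * ⟪x, S.simple j⟫ := by
  conv_lhs => rw [← S.sum_co y]
  rw [inner_sum]; simp [real_inner_smul_right]

lemma dom_nonneg {x : V} (hx : S.Dom x) {α : V} (h : α ∈ S.Rpos) : 0 ≤ ⟪x, α⟫ := by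
  rw [S.inner_eq_sum]
  exact Finset.sum_nonneg fun j _ => mul_nonneg (S.co_nonneg h j) (hx j)

lemma zeta_pos {α : V} (h : α ∈ S.Rpos) : 0 < ⟪S.zeta, α⟫ := by
  have h0 : 0 ≤ ⟪S.zeta, α⟫ := S.dom_nonneg (fun j => by rw [zeta_simple]; norm_num) h
  refine lt_of_le_of_ne h0 fun hz => S.ne_zero (S.pos_R h) ?_
  rw [S.inner_eq_sum] at hz
  have := (Finset.sum_eq_zero_iff_of_nonneg (fun j _ => by
    rw [zeta_simple, mul_one]; exact S.co_nonneg h j)).mp hz.symm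
  rw [← S.sum_co α]
  refine Finset.sum_eq_zero fun j hj => ?_
  have h2 := this j hj
  rw [zeta_simple, mul_one] at h2
  rw [h2, zero_smul]

lemma pos_of_zeta {α : V} (h : α ∈ S.R0) (hz : 0 < ⟪S.zeta, α⟫) : α ∈ S.Rpos := by
  rcases S.pos_or_neg h with h | h
  · exact h
  · have := S.zeta_pos h
    rw [inner_neg_right] at this; linarith

/-- pairing of a dominant vector decides positivity -/
lemma pos_of_dom {x : V} (hx : S.Dom x) {α : V} (h : α ∈ S.R0) (hp : 0 < ⟪x, α⟫) :
    α ∈ S.Rpos := by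
  rcases S.pos_or_neg h with h | h
  · exact h
  · have := S.dom_nonneg hx h
    rw [inner_neg_right] at this; linarith

lemma zeta_sr (α : V) (j : Fin S.n) :
    ⟪S.zeta, sr (S.simple j) α⟫ = ⟪S.zeta, α⟫ - ⟪α, coroot (S.simple j)⟫ := by
  rw [sr_apply, inner_sub_right, real_inner_smul_right, zeta_simple, mul_one]

lemma inner_coroot_pos {α : V} (h : α ∈ S.R0) (x : V) :
    0 < ⟪x, coroot α⟫ ↔ 0 < ⟪x, α⟫ := by
  have := S.ipos h
  rw [inner_coroot]
  constructor
  · intro h1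
    rw [lt_div_iff₀ this] at h1; linarith
  · intro h1; positivity

lemma inner_coroot_neg {α : V} (h : α ∈ S.R0) (x : V) :
    ⟪x, coroot α⟫ < 0 ↔ ⟪x, α⟫ < 0 := by
  have := S.inner_coroot_pos h (-x)
  simpa using this

/-- Well-founded induction on a finite set with a real valued height. -/
lemma fin_induct {A : Type*} (s : Set A) (ht : A → ℝ)
    (hf : ∀ a ∈ s, {b ∈ s | ht b < ht a}.Finite) (P : A → Prop)
    (h : ∀ a ∈ s, (∀ b ∈ s, ht b < ht a → P b) → P a) : ∀ a ∈ s, P a := by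
  have : ∀ N : ℕ, ∀ a ∈ s, {b ∈ s | ht b < ht a}.ncard ≤ N → P a := by
    intro N
    induction N with
    | zero =>
      intro a ha hN
      refine h a ha fun b hb hlt => ?_
      exfalso
      have h0 : {b ∈ s | ht b < ht a} = ∅ := (Set.ncard_eq_zero (hf a ha)).mp (by omega)
      have : b ∈ {b ∈ s | ht b < ht a} := ⟨hb, hlt⟩
      rw [h0] at this; exact this
    | succ N ih =>
      intro a ha hN
      refine h a ha fun b hb hlt => ih b hb ?_
      have : {x ∈ s | ht x < ht b} ⊂ {x ∈ s | ht x < ht a} := by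
        refine ⟨fun x hx => ⟨hx.1, hx.2.trans hlt⟩, fun hsub => ?_⟩
        have := hsub (⟨hb, hlt⟩ : b ∈ {x ∈ s | ht x < ht a})
        exact lt_irrefl _ this.2
      have := Set.ncard_lt_ncard this (hf a ha)
      omega
  exact fun a ha => this _ a ha le_rfl

lemma pos_induct (P : V → Prop) (h1 : ∀ j, P (S.simple j))
    (h2 : ∀ α ∈ S.Rpos, ∀ j, 0 < ⟪α, S.simple j⟫ → sr (S.simple j) α ∈ S.Rpos →
      P (sr (S.simple j) α) → P α) : ∀ α ∈ S.Rpos, P α := by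
  refine fin_induct (S.Rpos : Set V) (fun α => ⟪S.zeta, α⟫)
    (fun a _ => (S.Rpos.finite_toSet).subset fun x hx => hx.1) P ?_
  intro α hα ih
  by_cases hs : ∃ j, α = S.simple j
  · obtain ⟨j, rfl⟩ := hs; exact h1 j
  · push Not at hs
    have : ∃ j, 0 < ⟪α, S.simple j⟫ := by
      by_contra hc
      push Not at hc
      have h3 := S.ipos (S.pos_R hα)
      rw [S.inner_eq_sum] at h3
      have : ∑ j, S.co j α * ⟪α, S.simple j⟫ ≤ 0 :=
        Finset.sum_nonpos fun j _ => mul_nonpos_of_nonneg_of_nonpos (S.co_nonneg hα j) (hc j)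
      linarith
    obtain ⟨j, hj⟩ := this
    have h3 := S.simple_perm hα (hs j)
    refine h2 α hα j hj h3 (ih _ h3 ?_)
    have := (S.inner_coroot_pos (S.simple_R j) α).mpr hj
    show ⟪S.zeta, sr (S.simple j) α⟫ < ⟪S.zeta, α⟫
    rw [zeta_sr]; linarith

lemma dom_induct (P : V → Prop) (h1 : ∀ α ∈ S.R0, S.Dom α → P α)
    (h2 : ∀ α ∈ S.R0, ∀ j, ⟪α, S.simple j⟫ < 0 → P (sr (S.simple j) α) → P α) :
    ∀ α ∈ S.R0, P α := by
  refine fin_induct (S.R0 : Set V) (fun α => -⟪S.zeta, α⟫)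
    (fun a _ => (S.R0.finite_toSet).subset fun x hx => hx.1) P ?_
  intro α hα ih
  by_cases hd : S.Dom α
  · exact h1 α hα hd
  · unfold Dom at hd
    push Not at hd
    obtain ⟨j, hj⟩ := hd
    refine h2 α hα j hj (ih _ (S.sr_mem (S.simple_R j) hα) ?_)
    have := (S.inner_coroot_neg (S.simple_R j) α).mpr hj
    show -⟪S.zeta, sr (S.simple j) α⟫ < -⟪S.zeta, α⟫
    rw [zeta_sr]; linarith

end

section

variable (S : Setup V)

/-! ### The hat map and the root theta -/

lemma exists_g : ∃ g : ℝ → ℝ, (∀ x, 0 < x → 0 < g x) ∧ ∀ α, S.hat α = g ⟪α, α⟫ • α := by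
  rcases S.admissible with ⟨h, _⟩ | ⟨h, _⟩
  · exact ⟨fun x => 2 / x, fun x hx => by positivity, fun α => by rw [h]; rfl⟩
  · refine ⟨fun _ => 2 / ⟪S.hroot, S.hroot⟫, fun x hx => ?_, h⟩
    have := S.ipos (S.pos_R S.hroot_mem)
    positivity

/-- The length dependent scaling of the hat map. -/
def g (α : V) : ℝ := S.exists_g.choose ⟪α, α⟫

lemma hat_eq (α : V) : S.hat α = S.g α • α := S.exists_g.choose_spec.2 α

lemma g_pos {α : V} (h : α ∈ S.R0) : 0 < S.g α := S.exists_g.choose_spec.1 _ (S.ipos h)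

lemma g_sr (α β : V) : S.g (sr α β) = S.g β := by unfold g; rw [sr_inner]

lemma g_neg (β : V) : S.g (-β) = S.g β := by unfold g; rw [inner_neg_neg]

lemma hat_sr (α β : V) : S.hat (sr α β) = sr α (S.hat β) := by
  rw [hat_eq, hat_eq, g_sr, map_smul]

lemma hat_neg (β : V) : S.hat (-β) = -S.hat β := by
  rw [hat_eq, hat_eq, g_neg, smul_neg]

lemma m_eq (α : V) : S.m α = 2 / (S.g α * ⟪α, α⟫) := by
  rw [m, hat_eq, real_inner_smul_right]

lemma m_pos {α : V} (h : α ∈ S.R0) : 0 < S.m α := by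
  have := S.g_pos h
  have := S.ipos h
  rw [m_eq]; positivity

lemma m_sr (α β : V) : S.m (sr α β) = S.m β := by rw [m_eq, m_eq, g_sr, sr_inner]

lemma m_neg (β : V) : S.m (-β) = S.m β := by rw [m_eq, m_eq, g_neg, inner_neg_neg]

lemma coroot_eq {α : V} (h : α ∈ S.R0) : coroot α = S.m α • S.hat α := by
  have := S.g_pos h
  have := S.ipos h
  rw [m_eq, hat_eq, smul_smul, coroot]
  congr 1; field_simp

lemma coroot_hat {α : V} (h : α ∈ S.R0) : coroot (S.hat α) = S.m α • α := by
  have := S.g_pos h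
  have := S.ipos h
  rw [m_eq, hat_eq, coroot, smul_smul, real_inner_smul_left, real_inner_smul_right]
  congr 1; field_simp

lemma hat_pos {α : V} (h : α ∈ S.R0) (x : V) : 0 < ⟪x, S.hat α⟫ ↔ 0 < ⟪x, α⟫ := by
  have := S.g_pos h
  rw [hat_eq, real_inner_smul_right]
  exact mul_pos_iff_of_pos_left this

lemma hat_nonneg {α : V} (h : α ∈ S.R0) (x : V) : 0 ≤ ⟪x, S.hat α⟫ ↔ 0 ≤ ⟪x, α⟫ := by
  have := S.g_pos h
  rw [hat_eq, real_inner_smul_right]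
  exact mul_nonneg_iff_of_pos_left this

lemma hat_zero {α : V} (h : α ∈ S.R0) (x : V) : ⟪x, S.hat α⟫ = 0 ↔ ⟪x, α⟫ = 0 := by
  have := S.g_pos h
  rw [hat_eq, real_inner_smul_right]
  simp [this.ne']

lemma hroot_dom : S.Dom S.hroot := by
  intro j
  by_contra hc
  push Not at hc
  have h1 := (S.inner_coroot_neg (S.simple_R j) S.hroot).mpr hc
  obtain ⟨f, hf⟩ := S.hroot_highest _ (S.sr_mem (S.simple_R j) (S.pos_R S.hroot_mem))
  have h2 := congrArg (S.co j) hf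
  rw [S.co_sum (fun j => (f j : ℝ)), sr_apply, sub_sub_cancel, map_smul, co_simple] at h2
  simp only [if_true, smul_eq_mul, mul_one] at h2
  have : (0 : ℝ) ≤ f j := by positivity
  linarith

lemma hs_dom : S.Dom S.hs := by
  intro j
  by_contra hc
  push Not at hc
  have h1 := (S.inner_coroot_neg (S.simple_R j) S.hs).mpr hc
  obtain ⟨f, hf⟩ := S.hs_highest _ (S.sr_mem (S.simple_R j) (S.pos_R S.hs_mem))
    (sr_inner _ _ _)
  have h2 := congrArg (S.co j) hf
  rw [S.co_sum (fun j => (f j : ℝ)), sr_apply, sub_sub_cancel, map_smul, co_simple] at h2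
  simp only [if_true, smul_eq_mul, mul_one] at h2
  have : (0 : ℝ) ≤ f j := by positivity
  linarith

lemma hroot_long : ∀ α ∈ S.R0, ⟪α, α⟫ ≤ ⟪S.hroot, S.hroot⟫ := by
  refine S.dom_induct _ (fun α hα hd => ?_) (fun α hα j _ h => ?_)
  · obtain ⟨f, hf⟩ := S.hroot_highest α hα
    have key : ∀ x, S.Dom x → 0 ≤ ⟪x, S.hroot - α⟫ := by
      intro x hx
      rw [hf, inner_sum]
      refine Finset.sum_nonneg fun j _ => ?_
      rw [real_inner_smul_right]
      exact mul_nonneg (by positivity) (hx j)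
    have h1 := key _ hd
    have h2 := key _ S.hroot_dom
    rw [inner_sub_right] at h1 h2
    rw [real_inner_comm] at h1
    linarith
  · rwa [sr_inner] at h

/-- The root `ϑ = -α₀`. -/
def theta : V := -S.a0

lemma a0_eq : S.a0 = -S.theta := by simp [theta]

lemma theta_pos : S.theta ∈ S.Rpos := by
  unfold theta
  rcases S.admissible with ⟨_, h⟩ | ⟨_, h⟩ <;> rw [h, neg_neg]
  · exact S.hs_mem
  · exact S.hroot_mem

lemma theta_R : S.theta ∈ S.R0 := S.pos_R S.theta_pos

lemma theta_dom : S.Dom S.theta := by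
  unfold theta
  rcases S.admissible with ⟨_, h⟩ | ⟨_, h⟩ <;> rw [h, neg_neg]
  · exact S.hs_dom
  · exact S.hroot_dom

lemma hat_theta : S.hat S.theta = coroot S.theta := by
  unfold theta
  rcases S.admissible with ⟨h, h'⟩ | ⟨h, h'⟩
  · rw [h]
  · rw [h, h', neg_neg]; rfl

lemma m_theta : S.m S.theta = 1 := by
  rw [m, hat_theta, inner_coroot_self (S.ne_zero S.theta_R)]; norm_num

lemma coroot_hat_theta : coroot (S.hat S.theta) = S.theta := by
  rw [S.coroot_hat S.theta_R, m_theta, one_smul]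

lemma cryst_hat {α β : V} (hα : α ∈ S.R0) (hβ : β ∈ S.R0) :
    ∃ k : ℤ, ⟪S.hat α, coroot (S.hat β)⟫ = k := by
  rcases S.admissible with ⟨h, h'⟩ | ⟨h, h'⟩
  · have h1 : coroot (S.hat β) = β := by
      rw [S.coroot_hat hβ, m, h, inner_coroot_self (S.ne_zero hβ)]; simp
    rw [h1, h, real_inner_comm]
    exact S.cryst α hα β hβ
  · have h1 := S.ipos (S.pos_R S.hroot_mem)
    rw [S.coroot_hat hβ, m, h, h, real_inner_smul_right, real_inner_smul_right,
      real_inner_smul_left]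
    obtain ⟨k, hk⟩ := S.cryst β hβ α hα
    refine ⟨k, ?_⟩
    rw [← hk, inner_coroot]
    have := S.ipos hβ
    field_simp

lemma theta_int {α : V} (hα : α ∈ S.R0) : ∃ k : ℤ, ⟪S.theta, S.hat α⟫ = k := by
  obtain ⟨k, hk⟩ := S.cryst_hat hα S.theta_R
  rw [coroot_hat_theta, real_inner_comm] at hk
  exact ⟨k, hk⟩

lemma theta_ge_two {α : V} (hα : α ∈ S.R0) (h2 : 2 ≤ ⟪S.theta, S.hat α⟫) : α = S.theta := by
  have key : ⟪S.theta - α, S.theta - α⟫ ≤ 0 := by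
    rw [inner_sub_left, inner_sub_right, inner_sub_right, real_inner_comm S.theta α]
    have h0 := S.ipos hα
    rcases S.admissible with ⟨h, h'⟩ | ⟨h, h'⟩
    · have h3 : S.theta = S.hs := by rw [theta, h', neg_neg]
      have h4 := S.hs_short α hα
      rw [h, inner_coroot, le_div_iff₀ h0] at h2
      rw [h3] at h2 ⊢
      linarith
    · have h3 : S.theta = S.hroot := by rw [theta, h', neg_neg]
      have h4 := S.hroot_long α hα
      have h5 := S.ipos (S.pos_R S.hroot_mem)
      rw [h, real_inner_smul_right, div_mul_eq_mul_div, le_div_iff₀ h5] at h2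
      rw [h3] at h2 ⊢
      linarith
  have : S.theta - α = 0 := by
    rw [real_inner_self_eq_norm_sq] at key
    have : ‖S.theta - α‖ = 0 := by
      have := sq_nonneg ‖S.theta - α‖
      exact pow_eq_zero_iff (two_ne_zero) |>.mp (le_antisymm key this)
    exact norm_eq_zero.mp this
  exact (sub_eq_zero.mp this).symm

lemma theta_le_one {α : V} (hα : α ∈ S.R0) (hne : α ≠ S.theta) {k : ℤ}
    (hk : ⟪S.theta, S.hat α⟫ = k) : k ≤ 1 := by
  by_contra hc
  refine hne (S.theta_ge_two hα ?_)
  rw [hk]; exact_mod_cast (by omega : 2 ≤ k)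

lemma theta_ge_neg_one {α : V} (hα : α ∈ S.R0) (hne : α ≠ -S.theta) {k : ℤ}
    (hk : ⟪S.theta, S.hat α⟫ = k) : -1 ≤ k := by
  have := S.theta_le_one (S.neg_mem hα) (fun h => hne (by rw [← h, neg_neg])) (k := -k)
    (by rw [hat_neg, inner_neg_right, hk]; push_cast; rfl)
  omega

lemma theta_two : ⟪S.theta, S.hat S.theta⟫ = 2 := by
  rw [hat_theta, inner_coroot_self (S.ne_zero S.theta_R)]

lemma simple_inner_nonpos {i j : Fin S.n} (h : i ≠ j) : ⟪S.simple i, S.simple j⟫ ≤ 0 := by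
  by_contra hc
  push Not at hc
  have h1 : S.simple i ≠ S.simple j := fun he => h (S.linInd.injective he)
  have h2 := S.co_nonneg (S.simple_perm (S.simple_mem i) h1) j
  rw [sr_apply, map_sub, map_smul, co_simple, co_simple, if_neg h, if_pos rfl] at h2
  have := (S.inner_coroot_pos (S.simple_R j) (S.simple i)).mpr hc
  simp at h2
  linarith

lemma theta_full (j : Fin S.n) : 0 < S.co j S.theta := by
  by_contra hc
  have hj0 : S.co j S.theta = 0 := le_antisymm (not_lt.mp hc) (S.co_nonneg S.theta_pos j)
  have orth : ∀ i k, S.co i S.theta = 0 → S.co k S.theta ≠ 0 →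
      ⟪S.simple i, S.simple k⟫ = 0 := by
    intro i k hi hk
    have h1 := S.theta_dom i
    rw [real_inner_comm, S.inner_eq_sum] at h1
    have h2 : ∀ l ∈ Finset.univ, S.co l S.theta * ⟪S.simple i, S.simple l⟫ ≤ 0 := by
      intro l _
      by_cases hl : l = i
      · rw [hl, hi, zero_mul]
      · exact mul_nonpos_of_nonneg_of_nonpos (S.co_nonneg S.theta_pos l)
          (S.simple_inner_nonpos (Ne.symm hl))
    have h3 := (Finset.sum_eq_zero_iff_of_nonpos h2).mp
      (le_antisymm (Finset.sum_nonpos h2) h1) k (Finset.mem_univ k)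
    rcases mul_eq_zero.mp h3 with h | h
    · exact absurd h hk
    · exact h
  let A : Set V := {α | α ∈ S.R0 ∧ ∀ i, S.co i S.theta = 0 → S.co i α = 0}
  let B : Set V := {α | α ∈ S.R0 ∧ ∀ i, S.co i S.theta ≠ 0 → S.co i α = 0}
  have hpos : ∀ α ∈ S.Rpos, α ∈ A ∨ α ∈ B := by
    refine S.pos_induct _ (fun k => ?_) ?_
    · by_cases hk : S.co k S.theta = 0
      · right
        refine ⟨S.simple_R k, fun i hi => ?_⟩
        rw [co_simple, if_neg]; rintro rfl; exact hi hk
      · left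
        refine ⟨S.simple_R k, fun i hi => ?_⟩
        rw [co_simple, if_neg]; rintro rfl; exact hk hi
    · intro α hα k hk hsr ih
      have hα' : α = sr (S.simple k) α + ⟪α, coroot (S.simple k)⟫ • S.simple k := by
        rw [sr_apply]; abel
      have hk' : ⟪sr (S.simple k) α, S.simple k⟫ ≠ 0 := by
        rw [sr_inner_left, sr_self (S.ne_zero (S.simple_R k)), inner_neg_right]
        linarith
      rcases ih with ih | ih
      · left
        refine ⟨S.pos_R hα, fun i hi => ?_⟩
        rw [hα', map_add, ih.2 i hi, map_smul, co_simple]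
        have : k ≠ i := by
          rintro rfl
          apply hk'
          rw [real_inner_comm, S.inner_eq_sum]
          refine Finset.sum_eq_zero fun l _ => ?_
          by_cases hl : S.co l S.theta = 0
          · rw [ih.2 l hl, zero_mul]
          · rw [orth k l hi hl, mul_zero]
        rw [if_neg this]; simp
      · right
        refine ⟨S.pos_R hα, fun i hi => ?_⟩
        rw [hα', map_add, ih.2 i hi, map_smul, co_simple]
        have : k ≠ i := by
          rintro rfl
          apply hk'
          rw [real_inner_comm, S.inner_eq_sum]
          refine Finset.sum_eq_zero fun l _ => ?_
          by_cases hl : S.co l S.theta = 0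
          · rw [real_inner_comm, orth l k hl hi, mul_zero]
          · rw [ih.2 l hl, zero_mul]
        rw [if_neg this]; simp
  refine S.irred ⟨A, B, ⟨S.theta, S.theta_R, fun i hi => hi⟩, ⟨S.simple j, S.simple_R j, ?_⟩,
    ?_, ?_⟩
  · intro i hi
    rw [co_simple, if_neg]; rintro rfl; exact hi hj0
  · ext α
    constructor
    · rintro (h | h)
      · exact h.1
      · exact h.1
    · intro h
      rcases S.pos_or_neg h with hp | hp
      · exact hpos α hp
      · rcases hpos _ hp with h' | h'
        · left; exact ⟨h, fun i hi => by simpa using h'.2 i hi⟩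
        · right; exact ⟨h, fun i hi => by simpa using h'.2 i hi⟩
  · intro α hα β hβ
    rw [S.inner_eq_sum]
    refine Finset.sum_eq_zero fun k _ => ?_
    by_cases hk : S.co k S.theta = 0
    · rw [real_inner_comm, S.inner_eq_sum (S.simple k) α, Finset.sum_eq_zero, mul_zero]
      intro l _
      by_cases hl : S.co l S.theta = 0
      · rw [hα.2 l hl, zero_mul]
      · rw [orth k l hk hl, mul_zero]
    · rw [hβ.2 k hk, zero_mul]

lemma dom_theta_pos {α : V} (hα : α ∈ S.R0) (hd : S.Dom α) : 0 < ⟪S.theta, α⟫ := by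
  rw [real_inner_comm, S.inner_eq_sum]
  have h0 : ∀ j ∈ Finset.univ, 0 ≤ S.co j S.theta * ⟪α, S.simple j⟫ :=
    fun j _ => mul_nonneg (S.theta_full j).le (hd j)
  refine lt_of_le_of_ne (Finset.sum_nonneg h0) fun hc => ?_
  have h1 := (Finset.sum_eq_zero_iff_of_nonneg h0).mp hc.symm
  have h2 := S.ipos hα
  rw [S.inner_eq_sum, Finset.sum_eq_zero] at h2
  · exact lt_irrefl _ h2
  · intro j hj
    rcases mul_eq_zero.mp (h1 j hj) with h | h
    · exact absurd h (S.theta_full j).ne'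
    · rw [h, mul_zero]

lemma hat_high {x : V} (hx : S.Dom x) : ∀ α ∈ S.R0, ⟪x, S.hat α⟫ ≤ ⟪x, S.hat S.theta⟫ := by
  refine S.dom_induct _ (fun α hα hd => ?_) (fun α hα j hj h => ?_)
  · obtain ⟨k, hk⟩ := S.theta_int hα
    by_cases hne : α = S.theta
    · rw [hne]
    have h1 := S.dom_theta_pos hα hd
    have h2 := (S.hat_pos hα S.theta).mpr h1
    have h3 := S.theta_le_one hα hne hk
    rw [hk] at h2
    have h4 : k = 1 := by
      have : 0 < k := by exact_mod_cast h2
      omega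
    have h5 : S.hat (sr S.theta α) = S.hat α - S.hat S.theta := by
      rw [hat_sr, sr_apply, hat_theta]
      have h6 : ⟪S.hat α, coroot S.theta⟫ • S.theta = ⟪S.theta, S.hat α⟫ • coroot S.theta := by
        rw [inner_coroot, coroot, smul_smul, real_inner_comm]; congr 1; ring
      rw [h6, hk, h4]; simp
    have h7 : -(sr S.theta α) ∈ S.Rpos := by
      refine S.pos_of_dom S.theta_dom (S.neg_mem (S.sr_mem S.theta_R hα)) ?_
      rw [inner_neg_right, ← sr_inner_left, sr_self (S.ne_zero S.theta_R), inner_neg_left]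
      linarith
    have h8 := S.dom_nonneg hx h7
    rw [← S.hat_nonneg (S.pos_R h7), hat_neg, h5, inner_neg_right, inner_sub_right] at h8
    linarith
  · refine le_trans ?_ h
    have h1 := (S.inner_coroot_neg (S.simple_R j) α).mpr hj
    rw [hat_eq, hat_eq, g_sr, real_inner_smul_right, real_inner_smul_right, sr_apply,
      inner_sub_right, real_inner_smul_right]
    refine mul_le_mul_of_nonneg_left ?_ (S.g_pos hα).le
    have := mul_nonneg (neg_nonneg.mpr h1.le) (hx j)
    linarith

end

section

variable (S : Setup V)

/-! ### Affine roots -/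

lemma alpha_zero : S.alpha 0 = -S.theta := by simp [alpha, theta]

lemma alpha_succ (i : Fin S.n) : S.alpha i.succ = S.simple i := by simp [alpha]

lemma kconst_zero : S.kconst 0 = S.c := by simp [kconst]

lemma kconst_succ (i : Fin S.n) : S.kconst i.succ = 0 := by simp [kconst]

lemma alpha_R (j : Fin (S.n + 1)) : S.alpha j ∈ S.R0 := by
  refine Fin.cases ?_ (fun i => ?_) j
  · rw [alpha_zero]; exact S.neg_mem S.theta_R
  · rw [alpha_succ]; exact S.simple_R i

lemma sgen_eq (j : Fin (S.n + 1)) (x : V) :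
    S.sgen j x = sr (S.alpha j) x - S.kconst j • S.alpha j := reflP_eq _ _ _

lemma sgen_eq' (j : Fin (S.n + 1)) (x : V) : S.sgen j x = x - S.aFun j x • S.alpha j := rfl

lemma sgen_sgen (j : Fin (S.n + 1)) (x : V) : S.sgen j (S.sgen j x) = x :=
  refl_involutive _ _ x

lemma sgen_inv (j : Fin (S.n + 1)) : (S.sgen j)⁻¹ = S.sgen j := by
  rw [inv_eq_iff_mul_eq_one]
  ext x; exact S.sgen_sgen j x

lemma sgen_mul (j : Fin (S.n + 1)) : S.sgen j * S.sgen j = 1 := by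
  ext x; exact S.sgen_sgen j x

lemma aFun_sgen (j : Fin (S.n + 1)) (x : V) : S.aFun j (S.sgen j x) = -S.aFun j x := by
  rw [sgen_eq', aFun, inner_sub_left, real_inner_smul_left,
    inner_coroot_self (S.ne_zero (S.alpha_R j)), aFun]
  ring

/-- The action of simple reflections on affine roots. -/
def sact (j : Fin (S.n + 1)) (p : V × ℤ) : V × ℤ :=
  (sr (S.alpha j) p.1, p.2 + if j = 0 then ⌊⟪S.theta, S.hat p.1⟫⌋ else 0)

/-- The simple affine roots. -/
def aroot (j : Fin (S.n + 1)) : V × ℤ := (S.alpha j, if j = 0 then 1 else 0)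

lemma affval_aroot (j : Fin (S.n + 1)) (x : V) : S.affval (S.aroot j) x = S.aFun j x := by
  refine Fin.cases ?_ (fun i => ?_) j
  · simp [affval, aroot, aFun, alpha_zero, m_neg, m_theta, kconst_zero]
  · simp [affval, aroot, aFun, kconst_succ, Fin.succ_ne_zero]

lemma affval_sact (j : Fin (S.n + 1)) {p : V × ℤ} (hp : p.1 ∈ S.R0) (x : V) :
    S.affval (S.sact j p) x = S.affval p (S.sgen j x) := by
  have hm := S.coroot_eq hp
  obtain ⟨k, hk⟩ := S.theta_int hp
  revert hk
  refine Fin.cases ?_ (fun i => ?_) j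
  · intro hk
    simp only [affval, sact, sgen_eq, if_true, coroot_sr, m_sr, kconst_zero]
    rw [inner_sub_left, sr_inner_left, real_inner_smul_left, hk, Int.floor_intCast, alpha_zero]
    have : ⟪-S.theta, coroot p.1⟫ = -(S.m p.1 * k) := by
      rw [hm, real_inner_smul_right, inner_neg_left, hk]; ring
    rw [this]; push_cast; ring
  · intro hk
    simp only [affval, sact, sgen_eq, coroot_sr, m_sr, kconst_succ, Fin.succ_ne_zero, if_false]
    rw [zero_smul, sub_zero, sr_inner_left, add_zero]

lemma sact_sact (j : Fin (S.n + 1)) (p : V × ℤ) (hp : p.1 ∈ S.R0) :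
    S.sact j (S.sact j p) = p := by
  obtain ⟨k, hk⟩ := S.theta_int hp
  unfold sact
  ext1
  · simp [sr_sr]
  · by_cases hj : j = 0
    · subst hj
      simp only [if_true, hk, alpha_zero, sr_neg, hat_sr]
      rw [← sr_inner_left, sr_self (S.ne_zero S.theta_R), inner_neg_left, hk,
        Int.floor_intCast, ← Int.cast_neg, Int.floor_intCast]
      ring
    · simp [hj]

lemma sact_aroot (j : Fin (S.n + 1)) :
    S.sact j (S.aroot j) = (-S.alpha j, if j = 0 then -1 else 0) := by
  unfold sact aroot
  ext1
  · simp [sr_self (S.ne_zero (S.alpha_R j))]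
  · by_cases hj : j = 0
    · subst hj
      have : ⟪S.theta, S.hat S.theta⟫ = ((2 : ℤ) : ℝ) := by rw [theta_two]; norm_num
      simp only [if_true, alpha_zero, hat_neg, inner_neg_right, this]
      rw [← Int.cast_neg, Int.floor_intCast]; norm_num
    · simp [hj]

lemma aroot_mem (j : Fin (S.n + 1)) : S.aroot j ∈ S.RplusP := by
  refine ⟨S.alpha_R j, ?_⟩
  refine Fin.cases ?_ (fun i => ?_) j
  · left; simp [aroot]
  · right; simp [aroot, Fin.succ_ne_zero, alpha_succ, S.simple_mem i]

lemma sact_mem (j : Fin (S.n + 1)) {p : V × ℤ} (hp : p ∈ S.RplusP) (hne : p ≠ S.aroot j) :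
    S.sact j p ∈ S.RplusP := by
  obtain ⟨α, r⟩ := p
  obtain ⟨hα, hr⟩ := hp
  simp only at hα hr
  refine ⟨S.sr_mem (S.alpha_R j) hα, ?_⟩
  revert hne
  refine Fin.cases ?_ (fun i => ?_) j
  · intro hne
    obtain ⟨k, hk⟩ := S.theta_int hα
    simp only [sact, if_true, hk, Int.floor_intCast, alpha_zero, sr_neg]
    have hθ2 := S.theta_two
    by_cases h1 : α = -S.theta
    · have hk2 : k = -2 := by
        rw [h1, hat_neg, inner_neg_right, theta_two] at hk
        exact_mod_cast hk.symm
      have hr2 : r ≠ 1 := by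
        rintro rfl
        exact hne (by simp [aroot, alpha_zero, h1])
      have hr0 : r ≠ 0 := by
        rintro rfl
        rcases hr with h | ⟨_, h⟩
        · omega
        · rw [h1] at h; exact S.not_neg_pos S.theta_pos h
      rcases hr with h | ⟨h, _⟩
      · by_cases h3 : r = 2
        · right
          refine ⟨by omega, ?_⟩
          rw [h1, map_neg, sr_self (S.ne_zero S.theta_R), neg_neg]; exact S.theta_pos
        · left; omega
      · exact absurd h hr0
    · have hk1 := S.theta_ge_neg_one hα h1 hk
      rcases hr with h | ⟨h, hpos⟩
      · by_cases h3 : 1 ≤ r + k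
        · exact Or.inl h3
        · right
          refine ⟨by omega, S.pos_of_dom S.theta_dom (S.sr_mem S.theta_R hα) ?_⟩
          rw [← sr_inner_left, sr_self (S.ne_zero S.theta_R), inner_neg_left]
          have h4 : ⟪S.theta, α⟫ < 0 := by
            have : ⟪S.theta, S.hat α⟫ < 0 := by rw [hk]; exact_mod_cast (by omega : k < 0)
            rw [hat_eq, real_inner_smul_right] at this
            have h5 := S.g_pos hα
            by_contra hc
            push Not at hc
            have := mul_nonneg h5.le hc
            linarith
          linarith
      · have h4 := (S.hat_nonneg hα S.theta).mpr (S.dom_nonneg S.theta_dom hpos)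
        rw [hk] at h4
        have h5 : 0 ≤ k := by exact_mod_cast h4
        by_cases h6 : k = 0
        · right
          refine ⟨by omega, ?_⟩
          have h7 : ⟪S.theta, α⟫ = 0 := by
            rw [← S.hat_zero hα, hk, h6]; simp
          rw [sr_apply, inner_coroot, real_inner_comm, h7]; simpa using hpos
        · left; omega
  · intro hne
    simp only [sact, Fin.succ_ne_zero, if_false, add_zero, alpha_succ]
    rcases hr with h | ⟨h, hpos⟩
    · exact Or.inl h
    · right
      refine ⟨h, S.simple_perm hpos ?_⟩
      rintro rfl
      exact hne (by simp [aroot, alpha_succ, h, Fin.succ_ne_zero])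

lemma sact_ne (j : Fin (S.n + 1)) {p : V × ℤ} (hp : p ∈ S.RplusP) :
    S.sact j p ≠ S.aroot j := by
  intro h
  have h1 : p = S.sact j (S.aroot j) := by rw [← h, S.sact_sact j p hp.1]
  rw [sact_aroot] at h1
  subst h1
  obtain ⟨_, h2⟩ := hp
  revert h2
  refine Fin.cases ?_ (fun i => ?_) j
  · simp
  · simp only [Fin.succ_ne_zero, if_false, alpha_succ]
    rintro (h | h)
    · omega
    · exact S.not_neg_pos (S.simple_mem i) h.2

lemma c_pos : (0 : ℝ) < S.c := by
  have := S.c_gt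
  exact_mod_cast (by omega : 0 < S.c)

lemma fin_bound (x : V) (b : ℝ) : {p | p ∈ S.RplusP ∧ S.affval p x < b}.Finite := by
  have : {p | p ∈ S.RplusP ∧ S.affval p x < b} ⊆
      ⋃ α ∈ (S.R0 : Set V), (fun r : ℤ => (α, r)) ''
        Set.Icc (0 : ℤ) ⌈(b - ⟪x, coroot α⟫) / (S.m α * S.c)⌉ := by
    rintro ⟨α, r⟩ ⟨⟨hα, hr⟩, hlt⟩
    simp only [Set.mem_iUnion]
    refine ⟨α, hα, r, ⟨?_, ?_⟩, rfl⟩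
    · simp only at hr
      rcases hr with h | h
      · omega
      · omega
    · have hm := S.m_pos hα
      have hc := S.c_pos
      simp only [affval] at hlt
      have : (r : ℝ) ≤ (b - ⟪x, coroot α⟫) / (S.m α * S.c) := by
        rw [le_div_iff₀ (by positivity)]; nlinarith
      exact_mod_cast this.trans (Int.le_ceil _)
  refine Set.Finite.subset (Set.Finite.biUnion S.R0.finite_toSet fun α _ => ?_) this
  exact (Set.finite_Icc _ _).image _

lemma Raff_fin (x : V) : (S.Raff x).Finite := S.fin_bound x 0

lemma Raff_step {j : Fin (S.n + 1)} {x : V} (h : S.aFun j x < 0) :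
    S.Raff x = insert (S.aroot j) (S.sact j '' S.Raff (S.sgen j x)) := by
  ext p
  constructor
  · intro hp
    by_cases hpa : p = S.aroot j
    · left; exact hpa
    · right
      refine ⟨S.sact j p, ⟨S.sact_mem j hp.1 hpa, ?_⟩, S.sact_sact j p hp.1.1⟩
      rw [S.affval_sact j hp.1.1, sgen_sgen]; exact hp.2
  · rintro (rfl | ⟨q, hq, rfl⟩)
    · exact ⟨S.aroot_mem j, by rw [affval_aroot]; exact h⟩
    · have hne : q ≠ S.aroot j := by
        rintro rfl
        have := hq.2
        rw [affval_aroot, aFun_sgen] at this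
        linarith
      exact ⟨S.sact_mem j hq.1 hne, by rw [S.affval_sact j hq.1.1]; exact hq.2⟩

lemma Raff_notMem (j : Fin (S.n + 1)) (x : V) :
    S.aroot j ∉ S.sact j '' S.Raff (S.sgen j x) := by
  rintro ⟨q, hq, hq'⟩
  exact S.sact_ne j hq.1 hq'

lemma sact_injOn (j : Fin (S.n + 1)) (x : V) : Set.InjOn (S.sact j) (S.Raff x) := by
  intro p hp q hq h
  rw [← S.sact_sact j p hp.1.1, h, S.sact_sact j q hq.1.1]

lemma card_step {j : Fin (S.n + 1)} {x : V} (h : S.aFun j x < 0) :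
    (S.Raff x).ncard = (S.Raff (S.sgen j x)).ncard + 1 := by
  rw [S.Raff_step h, Set.ncard_insert_of_notMem (S.Raff_notMem j x)
    ((S.Raff_fin _).image _), (S.sact_injOn j _).ncard_image]

lemma t_sr {α β : V} (hα : α ∈ S.R0) (hβ : β ∈ S.R0) : S.t (sr α β) = S.t β :=
  S.t_invariant α hα β hβ

lemma tBr_step {j : Fin (S.n + 1)} {x : V} (h : S.aFun j x < 0) :
    S.tBr x = (S.t (S.alpha j) : ℂ) * S.tBr (S.sgen j x) := by
  unfold tBr
  rw [S.Raff_step h, finprod_mem_insert _ (S.Raff_notMem j x) ((S.Raff_fin _).image _),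
    finprod_mem_image (S.sact_injOn j _)]
  congr 1
  refine finprod_mem_congr rfl fun p hp => ?_
  show ((S.t (sr (S.alpha j) p.1) : ℝ) : ℂ) = _
  rw [S.t_sr (S.alpha_R j) hp.1.1]

lemma tBr_ne (htne : ∀ α ∈ S.R0, S.t α ≠ 0) (x : V) : S.tBr x ≠ 0 := by
  unfold tBr
  rw [finprod_mem_eq_finite_toFinset_prod _ (S.Raff_fin x)]
  refine Finset.prod_ne_zero_iff.mpr fun p hp => ?_
  have := (Set.Finite.mem_toFinset _).mp hp
  exact_mod_cast htne _ this.1.1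

lemma Raff_Alc {x : V} (h : x ∈ S.Alc) : S.Raff x = ∅ := by
  ext p
  simp only [Set.mem_empty_iff_false, iff_false]
  rintro ⟨⟨hα, hr⟩, hlt⟩
  have hm := S.m_pos hα
  have hc := S.c_pos
  rw [affval, S.coroot_eq hα, real_inner_smul_right] at hlt
  have key : 0 ≤ ⟪x, S.hat p.1⟫ + p.2 * S.c := by
    rcases hr with h1 | ⟨h1, h2⟩
    · have hr1 : (1 : ℝ) ≤ p.2 := by exact_mod_cast h1
      have : -(S.c : ℝ) ≤ ⟪x, S.hat p.1⟫ := by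
        rcases S.pos_or_neg hα with h3 | h3
        · have := (h _ h3).1; linarith
        · have := (h _ h3).2
          rw [hat_neg, inner_neg_right] at this; linarith
      nlinarith
    · rw [h1]; have := (h _ h2).1; simpa using this
  have := mul_nonneg hm.le key
  nlinarith

lemma Alc_of_aFun {x : V} (h : ∀ j, 0 ≤ S.aFun j x) : x ∈ S.Alc := by
  have hd : S.Dom x := by
    intro j
    have := h j.succ
    rw [aFun, alpha_succ, kconst_succ, add_zero] at this
    by_contra hc
    push Not at hc
    have := (S.inner_coroot_neg (S.simple_R j) x).mpr hc
    linarith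
  intro α hα
  refine ⟨(S.hat_nonneg (S.pos_R hα) x).mpr (S.dom_nonneg hd hα), ?_⟩
  refine (S.hat_high hd α (S.pos_R hα)).trans ?_
  have := h 0
  rw [aFun, alpha_zero, coroot_neg, kconst_zero, inner_neg_right, ← hat_theta] at this
  linarith

lemma exists_neg {x : V} (h : x ∉ S.Alc) : ∃ j, S.aFun j x < 0 := by
  by_contra hc
  push Not at hc
  exact h (S.Alc_of_aFun hc)

end

section

variable (S : Setup V)

/-! ### Words in the affine Weyl group -/

/-- The product of a word. -/
def wp (l : List (Fin (S.n + 1))) : Equiv.Perm V := (l.map S.sgen).prod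

lemma wp_nil : S.wp [] = 1 := rfl

lemma wp_cons (j : Fin (S.n + 1)) (l : List (Fin (S.n + 1))) :
    S.wp (j :: l) = S.sgen j * S.wp l := by simp [wp]

lemma wp_append (l l' : List (Fin (S.n + 1))) : S.wp (l ++ l') = S.wp l * S.wp l' := by
  simp [wp]

/-- The group generated by the simple affine reflections. -/
def HG : Subgroup (Equiv.Perm V) := Subgroup.closure (Set.range S.sgen)

lemma sgen_HG (j : Fin (S.n + 1)) : S.sgen j ∈ S.HG := Subgroup.subset_closure ⟨j, rfl⟩

lemma HG_word {w : Equiv.Perm V} (hw : w ∈ S.HG) : ∃ l, S.wp l = w := by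
  refine Subgroup.closure_induction (p := fun w _ => ∃ l, S.wp l = w) ?_ ?_ ?_ ?_ hw
  · rintro _ ⟨j, rfl⟩; exact ⟨[j], by simp [wp]⟩
  · exact ⟨[], rfl⟩
  · rintro _ _ _ _ ⟨l, rfl⟩ ⟨l', rfl⟩; exact ⟨l ++ l', S.wp_append l l'⟩
  · rintro _ _ ⟨l, rfl⟩
    have hrev : ∀ l, S.wp l.reverse = (S.wp l)⁻¹ := by
      intro l
      induction l with
      | nil => simp [wp]
      | cons j l ih =>
        rw [List.reverse_cons, wp_append, ih, wp_cons, wp_cons, wp_nil, mul_one, mul_inv_rev,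
          sgen_inv]
    exact ⟨l.reverse, hrev l⟩

/-- Affine reflection attached to an affine root. -/
def rp (p : V × ℤ) : Equiv.Perm V := reflP p.1 (S.m p.1 * (p.2 : ℝ) * (S.c : ℝ))

lemma rp_apply (p : V × ℤ) (x : V) : S.rp p x = x - S.affval p x • p.1 := rfl

lemma sgen_sub (j : Fin (S.n + 1)) (x y : V) : S.sgen j (x - y) = S.sgen j x - sr (S.alpha j) y := by
  rw [sgen_eq, sgen_eq, map_sub]; abel

lemma rp_sact (j : Fin (S.n + 1)) {p : V × ℤ} (hp : p.1 ∈ S.R0) :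
    S.rp (S.sact j p) = S.sgen j * S.rp p * S.sgen j := by
  ext x
  show S.rp (S.sact j p) x = S.sgen j (S.rp p (S.sgen j x))
  rw [rp_apply, rp_apply, sgen_sub, sgen_sgen, map_smul, S.affval_sact j hp]
  rfl

lemma rp_aroot (j : Fin (S.n + 1)) : S.rp (S.aroot j) = S.sgen j := by
  ext x; rw [rp_apply, affval_aroot]; rfl

lemma exists_int : ∃ x0 : V, ∀ j, 0 < S.aFun j x0 := by
  have hs : 0 < ⟪S.zeta, coroot S.theta⟫ :=
    (S.inner_coroot_pos S.theta_R _).mpr (S.zeta_pos S.theta_pos)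
  have hc := S.c_pos
  refine ⟨(S.c / (2 * ⟪S.zeta, coroot S.theta⟫)) • S.zeta, fun j => ?_⟩
  refine Fin.cases ?_ (fun i => ?_) j
  · rw [aFun, alpha_zero, coroot_neg, inner_neg_right, real_inner_smul_left, kconst_zero]
    field_simp
    linarith
  · rw [aFun, alpha_succ, real_inner_smul_left, kconst_succ, add_zero]
    have := (S.inner_coroot_pos (S.simple_R i) S.zeta).mpr (by rw [zeta_simple]; norm_num)
    positivity

lemma exists_alpha_pos {α : V} (hα : α ∈ S.R0) : ∃ j, 0 < ⟪α, S.alpha j⟫ := by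
  by_contra hc
  push Not at hc
  have hd : S.Dom (-α) := fun i => by
    have := hc i.succ
    rw [alpha_succ] at this
    rw [inner_neg_left]; linarith
  have h1 := S.dom_theta_pos (S.neg_mem hα) hd
  have h2 := hc 0
  rw [alpha_zero, inner_neg_right, real_inner_comm] at h2
  rw [inner_neg_right] at h1
  linarith

lemma rp_HG : ∀ p ∈ S.RplusP, S.rp p ∈ S.HG := by
  obtain ⟨x0, hx0⟩ := S.exists_int
  refine fin_induct S.RplusP (fun p => S.affval p x0) (fun p _ => S.fin_bound x0 _) _ ?_
  intro p hp ih
  obtain ⟨j, hj⟩ := S.exists_alpha_pos hp.1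
  by_cases hpa : p = S.aroot j
  · rw [hpa, rp_aroot]; exact S.sgen_HG j
  · have h1 := ih _ (S.sact_mem j hp hpa) (by
      show S.affval (S.sact j p) x0 < S.affval p x0
      rw [S.affval_sact j hp.1, sgen_eq', affval, affval, inner_sub_left, real_inner_smul_left]
      have h2 : 0 < ⟪S.alpha j, coroot p.1⟫ := by
        rw [S.inner_coroot_pos hp.1, real_inner_comm]; exact hj
      have := mul_pos (hx0 j) h2
      linarith)
    rw [← S.sact_sact j p hp.1, S.rp_sact j (S.sr_mem (S.alpha_R j) hp.1)]
    exact mul_mem (mul_mem (S.sgen_HG j) h1) (S.sgen_HG j)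

lemma reflP_neg (α : V) (k : ℝ) : reflP (-α) (-k) = reflP α k := by
  ext x; rw [reflP_eq, reflP_eq, sr_neg]; simp

lemma W_le : S.W ≤ S.HG := by
  rw [W, Subgroup.closure_le]
  rintro _ ⟨α, hα, r, rfl⟩
  by_cases h : ((α, r) : V × ℤ) ∈ S.RplusP
  · exact S.rp_HG _ h
  · have h' : ((-α, -r) : V × ℤ) ∈ S.RplusP := by
      refine ⟨S.neg_mem hα, ?_⟩
      by_contra hc
      apply h
      refine ⟨hα, ?_⟩
      simp only [not_or, not_and, not_le] at hc ⊢
      obtain ⟨hc1, hc2⟩ := hc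
      by_cases hr : r = 0
      · right
        refine ⟨hr, ?_⟩
        exact (S.pos_partition α hα).mpr (hc2 (by omega))
      · left; omega
    have := S.rp_HG _ h'
    simp only [rp, m_neg] at this
    have h2 : S.m α * ((-r : ℤ) : ℝ) * (S.c : ℝ) = -(S.m α * (r : ℝ) * (S.c : ℝ)) := by
      push_cast; ring
    rw [h2, reflP_neg] at this
    exact this

lemma sgen_W (j : Fin (S.n + 1)) : S.sgen j ∈ S.W := by
  rw [← rp_aroot]
  exact Subgroup.subset_closure ⟨_, S.alpha_R j, _, rfl⟩

lemma wp_W (l : List (Fin (S.n + 1))) : S.wp l ∈ S.W := by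
  induction l with
  | nil => exact one_mem _
  | cons j l ih => rw [wp_cons]; exact mul_mem (S.sgen_W j) ih

lemma W0_le_W : S.W0 ≤ S.W := by
  rw [W0, Subgroup.closure_le]
  rintro _ ⟨α, hα, rfl⟩
  exact Subgroup.subset_closure ⟨α, hα, 0, by simp⟩

lemma sgen_succ (i : Fin S.n) : S.sgen i.succ = reflP (S.simple i) 0 := by
  rw [sgen, alpha_succ, kconst_succ]

lemma W0_le : S.W0 ≤ Subgroup.closure (Set.range fun i : Fin S.n => S.sgen i.succ) := by
  rw [W0, Subgroup.closure_le]
  have key : ∀ α ∈ S.Rpos,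
      reflP α 0 ∈ Subgroup.closure (Set.range fun i : Fin S.n => S.sgen i.succ) := by
    refine S.pos_induct _ (fun i => Subgroup.subset_closure ⟨i, S.sgen_succ i⟩) ?_
    intro α _ i _ _ ih
    have h1 : reflP α 0 = S.sgen i.succ * reflP (sr (S.simple i) α) 0 * S.sgen i.succ := by
      ext x
      rw [sgen_succ]
      show reflP α 0 x = reflP (S.simple i) 0 (reflP _ 0 (reflP (S.simple i) 0 x))
      simp only [reflP_zero]
      rw [sr_conj, sr_sr, sr_sr]
    have h2 := Subgroup.subset_closure (k := Set.range fun i : Fin S.n => S.sgen i.succ)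
      ⟨i, rfl⟩
    rw [h1]
    exact mul_mem (mul_mem h2 ih) h2
  rintro _ ⟨α, hα, rfl⟩
  rcases S.pos_or_neg hα with h | h
  · exact key α h
  · have := key _ h
    rw [← reflP_neg, neg_neg, neg_zero] at this
    exact this

/-! ### The weight lattice -/

/-- The weight lattice as a subgroup. -/
def PG : AddSubgroup V where
  carrier := S.Plat
  add_mem' := by
    intro a b ha hb α hα
    obtain ⟨k, hk⟩ := ha α hα
    obtain ⟨l, hl⟩ := hb α hα
    exact ⟨k + l, by rw [inner_add_left, hk, hl]; push_cast; rfl⟩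
  zero_mem' := fun α _ => ⟨0, by simp⟩
  neg_mem' := by
    intro a ha α hα
    obtain ⟨k, hk⟩ := ha α hα
    exact ⟨-k, by rw [inner_neg_left, hk]; push_cast; rfl⟩

lemma root_PG {α : V} (h : α ∈ S.R0) : α ∈ S.PG := fun β hβ => S.cryst β hβ α h

lemma zsmul_PG {x : V} (h : x ∈ S.PG) (k : ℤ) : (k : ℝ) • x ∈ S.PG := by
  rw [Int.cast_smul_eq_zsmul]; exact S.PG.zsmul_mem h k

lemma aFun_int (j : Fin (S.n + 1)) {x : V} (hx : x ∈ S.Plat) : ∃ k : ℤ, S.aFun j x = k := by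
  obtain ⟨k, hk⟩ := hx _ (S.alpha_R j)
  revert hk
  refine Fin.cases ?_ (fun i => ?_) j
  · intro hk
    exact ⟨k + S.c, by rw [aFun, hk, kconst_zero]; push_cast; rfl⟩
  · intro hk
    exact ⟨k, by rw [aFun, hk, kconst_succ, add_zero]⟩

lemma sgen_Plat (j : Fin (S.n + 1)) {x : V} (hx : x ∈ S.Plat) : S.sgen j x ∈ S.Plat := by
  obtain ⟨k, hk⟩ := S.aFun_int j hx
  rw [sgen_eq', hk]
  exact S.PG.sub_mem hx (S.zsmul_PG (S.root_PG (S.alpha_R j)) k)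

lemma wp_Plat (l : List (Fin (S.n + 1))) {x : V} (hx : x ∈ S.Plat) : S.wp l x ∈ S.Plat := by
  induction l with
  | nil => exact hx
  | cons j l ih => rw [wp_cons]; exact S.sgen_Plat j ih

lemma W_Plat {w : Equiv.Perm V} (hw : w ∈ S.W) {x : V} (hx : x ∈ S.Plat) : w x ∈ S.Plat := by
  obtain ⟨l, rfl⟩ := S.HG_word (S.W_le hw)
  exact S.wp_Plat l hx

/-! ### Length and shortest elements -/

lemma len_le (l : List (Fin (S.n + 1))) : S.len (S.wp l) ≤ l.length :=
  Nat.sInf_le ⟨l, rfl, rfl⟩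

lemma exists_red {w : Equiv.Perm V} (hw : w ∈ S.W) : ∃ l, S.IsReducedWord l w := by
  obtain ⟨l, hl⟩ := S.HG_word (S.W_le hw)
  have : {k | ∃ l : List (Fin (S.n + 1)), l.length = k ∧ (l.map S.sgen).prod = w}.Nonempty :=
    ⟨_, l, rfl, hl⟩
  obtain ⟨l', h1, h2⟩ := Nat.sInf_mem this
  exact ⟨l', h2, h1⟩

lemma card_le (j : Fin (S.n + 1)) (y : V) :
    (S.Raff y).ncard ≤ (S.Raff (S.sgen j y)).ncard + 1 := by
  rcases lt_trichotomy (S.aFun j y) 0 with h | h | h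
  · exact (S.card_step h).le
  · rw [sgen_eq', h, zero_smul, sub_zero]; omega
  · have := S.card_step (j := j) (x := S.sgen j y) (by rw [aFun_sgen]; linarith)
    rw [sgen_sgen] at this
    omega

lemma card_wp (l : List (Fin (S.n + 1))) (x : V) :
    (S.Raff x).ncard ≤ l.length + (S.Raff (S.wp l x)).ncard := by
  induction l with
  | nil => simp [wp_nil]
  | cons j l ih =>
    rw [wp_cons, List.length_cons]
    have := S.card_le j (S.wp l x)
    show _ ≤ _ + (S.Raff (S.sgen j (S.wp l x))).ncard
    omega

lemma len_ge {w : Equiv.Perm V} (hw : w ∈ S.W) {x : V} (hx : w x ∈ S.Alc) :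
    (S.Raff x).ncard ≤ S.len w := by
  obtain ⟨l, h1, h2⟩ := S.exists_red hw
  have := S.card_wp l x
  have h3 : S.wp l = w := h1
  rw [h3, S.Raff_Alc hx] at this
  simpa [h2] using this

/-- The product of the parameters along a word. -/
def tp (l : List (Fin (S.n + 1))) : ℂ := (l.map fun j => (S.t (S.alpha j) : ℂ)).prod

lemma greedy : ∀ (N : ℕ) (x : V), (S.Raff x).ncard = N →
    ∃ l, l.length = N ∧ S.wp l x ∈ S.Alc ∧ S.tp l = S.tBr x := by
  intro N
  induction N with
  | zero =>
    intro x hx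
    refine ⟨[], rfl, ?_, ?_⟩
    · by_contra hc
      obtain ⟨j, hj⟩ := S.exists_neg hc
      have := S.card_step (x := x) hj
      omega
    · have : S.Raff x = ∅ := (Set.ncard_eq_zero (S.Raff_fin x)).mp hx
      simp [tp, tBr, this]
  | succ N ih =>
    intro x hx
    have : x ∉ S.Alc := by
      intro h
      rw [S.Raff_Alc h] at hx
      simp at hx
    obtain ⟨j, hj⟩ := S.exists_neg this
    have h1 := S.card_step hj
    obtain ⟨l, h2, h3, h4⟩ := ih (S.sgen j x) (by omega)
    refine ⟨l ++ [j], by simp [h2], ?_, ?_⟩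
    · rw [wp_append]; simpa [wp_cons, wp_nil] using h3
    · rw [S.tBr_step hj, ← h4]; simp [tp, mul_comm]

variable {S}
variable {wmin : V → Equiv.Perm V}

lemma greedy_unique (hwmin : S.IsShortest wmin) {x : V} {l : List (Fin (S.n + 1))}
    (h1 : l.length = (S.Raff x).ncard) (h2 : S.wp l x ∈ S.Alc) :
    S.wp l = wmin x ∧ S.IsReducedWord l (wmin x) := by
  obtain ⟨a, b, cc⟩ := hwmin x
  obtain ⟨d, e⟩ := cc (S.wp l) (S.wp_W l) h2
  have h3 := S.len_ge a b
  have h4 := S.len_le l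
  have h5 : S.len (S.wp l) = S.len (wmin x) := by omega
  exact ⟨e h5, e h5, by omega⟩

lemma wmin_word (hwmin : S.IsShortest wmin) (x : V) :
    ∃ l, S.IsReducedWord l (wmin x) ∧ S.tp l = S.tBr x := by
  obtain ⟨l, h1, h2, h3⟩ := S.greedy _ x rfl
  exact ⟨l, (greedy_unique hwmin h1 h2).2, h3⟩

lemma wmin_step (hwmin : S.IsShortest wmin) {x : V} {j : Fin (S.n + 1)} (hj : S.aFun j x < 0) :
    wmin x x = wmin (S.sgen j x) (S.sgen j x) := by
  obtain ⟨l, h1, h2, _⟩ := S.greedy _ (S.sgen j x) rfl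
  have h3 := (greedy_unique hwmin h1 h2).1
  have h4 := greedy_unique hwmin (x := x) (l := l ++ [j])
    (by rw [S.card_step hj]; simp [h1]) (by rw [wp_append]; simpa [wp_cons, wp_nil] using h2)
  rw [← h3, ← h4.1, wp_append]
  simp [wp_cons, wp_nil]

lemma plus_sgen (hwmin : S.IsShortest wmin) (j : Fin (S.n + 1)) (x : V) :
    wmin (S.sgen j x) (S.sgen j x) = wmin x x := by
  rcases lt_trichotomy (S.aFun j x) 0 with h | h | h
  · exact (wmin_step hwmin h).symm
  · rw [sgen_eq', h, zero_smul, sub_zero]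
  · have := wmin_step hwmin (x := S.sgen j x) (j := j) (by rw [aFun_sgen]; linarith)
    rw [sgen_sgen] at this
    exact this

lemma plus_W (hwmin : S.IsShortest wmin) {w : Equiv.Perm V} (hw : w ∈ S.W) (x : V) :
    wmin (w x) (w x) = wmin x x := by
  obtain ⟨l, rfl⟩ := S.HG_word (S.W_le hw)
  induction l with
  | nil => rfl
  | cons j l ih =>
    rw [wp_cons]
    show wmin (S.sgen j (S.wp l x)) (S.sgen j (S.wp l x)) = _
    rw [plus_sgen hwmin, ih (S.wp_W l)]

/-! ### The final reduction -/

variable (S) in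
lemma ev_mem (f : ↥S.Plat → ℂ) {x : V} (h : x ∈ S.Plat) : S.ev f x = f ⟨x, h⟩ := dif_pos h

variable (S) in
/-- The operators `T_j` as linear maps. -/
def TL (j : Fin (S.n + 1)) : (↥S.Plat → ℂ) →ₗ[ℂ] (↥S.Plat → ℂ) where
  toFun := S.Top j
  map_add' f g := by
    have he : ∀ x, S.ev (f + g) x = S.ev f x + S.ev g x := by
      intro x; unfold ev; split_ifs <;> simp
    funext x
    simp only [Top, Jop, he, Pi.add_apply, Finset.sum_add_distrib]
    split_ifs <;> ring
  map_smul' r f := by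
    have he : ∀ x, S.ev (r • f) x = r * S.ev f x := by
      intro x; unfold ev; split_ifs <;> simp
    funext x
    simp only [Top, Jop, he, Pi.smul_apply, ← Finset.mul_sum, smul_eq_mul, RingHom.id_apply]
    split_ifs <;> ring

lemma TL_apply (j : Fin (S.n + 1)) (f : ↥S.Plat → ℂ) : S.TL j f = S.Top j f := rfl

lemma wordOp_cons (j : Fin (S.n + 1)) (l : List (Fin (S.n + 1))) (f : ↥S.Plat → ℂ) :
    S.wordOp (j :: l) f = S.TL j (S.wordOp l f) := rfl

lemma wordOp_eig {f : ↥S.Plat → ℂ} (hf : ∀ j, S.TL j f = (S.t (S.alpha j) : ℂ) • f)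
    (l : List (Fin (S.n + 1))) : S.wordOp l f = S.tp l • f := by
  induction l with
  | nil => simp [wordOp, tp]
  | cons j l ih =>
    rw [wordOp_cons, ih, map_smul, hf, smul_smul, tp, tp, List.map_cons, List.prod_cons, mul_comm]

lemma JJ_eq (htne : ∀ α ∈ S.R0, S.t α ≠ 0) (hwmin : S.IsShortest wmin)
    {TW : Equiv.Perm V → (↥S.Plat → ℂ) → (↥S.Plat → ℂ)} (hTW : S.IsTW TW)
    {f : ↥S.Plat → ℂ} (hf : ∀ j, S.TL j f = (S.t (S.alpha j) : ℂ) • f) (x : ↥S.Plat) :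
    S.JJ wmin TW f x = S.ev f (wmin x.1 x.1) := by
  obtain ⟨l, h1, h2⟩ := wmin_word hwmin x.1
  rw [JJ, hTW _ _ h1, wordOp_eig hf, h2]
  have he : ∀ y r, S.ev (r • f) y = r * S.ev f y := by
    intro x; unfold ev; split_ifs <;> simp
  rw [he, ← mul_assoc, inv_mul_cancel₀ (S.tBr_ne htne _), one_mul]

lemma JJ_inv (htne : ∀ α ∈ S.R0, S.t α ≠ 0) (hwmin : S.IsShortest wmin)
    {TW : Equiv.Perm V → (↥S.Plat → ℂ) → (↥S.Plat → ℂ)} (hTW : S.IsTW TW)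
    {f : ↥S.Plat → ℂ} (hf : ∀ j, S.TL j f = (S.t (S.alpha j) : ℂ) • f) :
    S.Winv (S.JJ wmin TW f) := by
  intro w hw x
  have hw' := S.W.inv_mem hw
  rw [S.ev_mem _ (S.W_Plat hw' x.2), JJ_eq htne hwmin hTW hf, JJ_eq htne hwmin hTW hf,
    plus_W hwmin hw']

variable (S) in
lemma transl_W : ∀ q ∈ S.Qhatvee, Equiv.addRight ((S.c : ℝ) • q) ∈ S.W := by
  intro q hq
  refine AddSubgroup.closure_induction
    (p := fun q _ => Equiv.addRight ((S.c : ℝ) • q) ∈ S.W) ?_ ?_ ?_ ?_ hq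
  · rintro _ ⟨α, hα, rfl⟩
    have : Equiv.addRight ((S.c : ℝ) • coroot (S.hat α)) =
        reflP α (S.m α * ((-1 : ℤ) : ℝ) * (S.c : ℝ)) * reflP α (S.m α * ((0 : ℤ) : ℝ) * (S.c : ℝ)) := by
      ext x
      show x + (S.c : ℝ) • coroot (S.hat α) = reflP α _ (reflP α _ x)
      rw [reflP_eq, reflP_eq, map_sub, sr_sr, S.coroot_hat hα, map_smul]
      simp [smul_smul, mul_comm]
    simp only [this]
    exact mul_mem (Subgroup.subset_closure ⟨α, hα, _, rfl⟩)
      (Subgroup.subset_closure ⟨α, hα, _, rfl⟩)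
  · convert S.W.one_mem using 1
    ext x; simp
  · intro a b _ _ ha hb
    convert mul_mem ha hb using 1
    ext x
    simp only [Equiv.coe_addRight, Equiv.Perm.coe_mul, Function.comp_apply, smul_add]
    abel
  · intro a _ ha
    convert S.W.inv_mem ha using 1
    ext x; simp [Equiv.Perm.inv_def, sub_eq_add_neg]

end

section

/-! ### The function `v_α` -/

/-- Closed form of the function `v`. -/
def vv (t x : ℝ) : ℝ := x + 2 * Real.arctan (t * Real.sin x / (1 - t * Real.cos x))

lemma den1_pos {t : ℝ} (ht : |t| < 1) (x : ℝ) : 0 < 1 - t * Real.cos x := by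
  have h1 := Real.abs_cos_le_one x
  have h2 : |t * Real.cos x| < 1 := by
    rw [abs_mul]
    nlinarith [abs_nonneg t, abs_nonneg (Real.cos x)]
  linarith [(abs_lt.mp h2).2]

lemma den2_pos {t : ℝ} (ht : |t| < 1) (x : ℝ) : 0 < 1 - 2 * t * Real.cos x + t ^ 2 := by
  have h1 := den1_pos ht x
  nlinarith [Real.sin_sq_add_cos_sq x, sq_nonneg (t * Real.sin x)]

lemma vv_deriv {t : ℝ} (ht : |t| < 1) (x : ℝ) :
    HasDerivAt (vv t) ((1 - t ^ 2) * (1 / (1 - 2 * t * Real.cos x + t ^ 2))) x := by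
  have h1 := den1_pos ht x
  have h2 := den2_pos ht x
  have hn : HasDerivAt (fun x => t * Real.sin x) (t * Real.cos x) x :=
    (Real.hasDerivAt_sin x).const_mul t
  have hd : HasDerivAt (fun x => 1 - t * Real.cos x) (t * Real.sin x) x := by
    exact (((Real.hasDerivAt_cos x).const_mul t).const_sub 1).congr_deriv (by ring)
  have hq := hn.div hd h1.ne'
  have := (hasDerivAt_id x).add ((hq.arctan).const_mul 2)
  refine this.congr_deriv ?_
  have hs := Real.sin_sq_add_cos_sq x
  have h3 : 1 + (t * Real.sin x / (1 - t * Real.cos x)) ^ 2 =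
      (1 - 2 * t * Real.cos x + t ^ 2) / (1 - t * Real.cos x) ^ 2 := by
    field_simp
    linear_combination t ^ 2 * hs
  show 1 + 2 * (1 / (1 + (t * Real.sin x / (1 - t * Real.cos x)) ^ 2) * _) = _
  rw [h3]
  field_simp
  linear_combination (-2 * t ^ 2) * hs

lemma vintOf_eq {s : V → ℝ} {α : V} (ht : |s α| < 1) (x : ℝ) : vintOf s α x = vv (s α) x := by
  have hc : Continuous fun y : ℝ => (1 - s α ^ 2) * (1 / (1 - 2 * s α * Real.cos y + s α ^ 2)) :=
    continuous_const.mul (continuous_const.div (by fun_prop) (fun y => (den2_pos ht y).ne'))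
  have := intervalIntegral.integral_eq_sub_of_hasDerivAt (a := 0) (b := x) (f := vv (s α))
    (fun y _ => vv_deriv ht y) (hc.intervalIntegrable _ _)
  rw [intervalIntegral.integral_const_mul] at this
  rw [vintOf, this]
  simp [vv]

lemma vv_neg (t x : ℝ) : vv t (-x) = -vv t x := by
  rw [vv, vv, Real.sin_neg, Real.cos_neg, mul_neg, neg_div, Real.arctan_neg]; ring

lemma vv_add (t x : ℝ) (k : ℤ) : vv t (x + k * (2 * Real.pi)) = vv t x + k * (2 * Real.pi) := by
  rw [vv, vv, Real.sin_add_int_mul_two_pi, Real.cos_add_int_mul_two_pi]; ring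

lemma vv_cont {t : ℝ} (ht : |t| < 1) : Continuous (vv t) :=
  continuous_iff_continuousAt.mpr fun x => (vv_deriv ht x).continuousAt

lemma exp_arctan (q : ℝ) : Complex.exp (Complex.I * (2 * Real.arctan q : ℝ)) * (1 - Complex.I * q) =
    1 + Complex.I * q := by
  have h1 : Complex.exp (Complex.I * (Real.arctan q : ℝ)) =
      (1 / Real.sqrt (1 + q ^ 2) : ℝ) * (1 + Complex.I * q) := by
    rw [mul_comm, Complex.exp_mul_I, ← Complex.ofReal_cos, ← Complex.ofReal_sin, Real.cos_arctan,
      Real.sin_arctan]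
    push_cast; ring
  have h2 : Complex.exp (Complex.I * (2 * Real.arctan q : ℝ)) =
      Complex.exp (Complex.I * (Real.arctan q : ℝ)) ^ 2 := by
    rw [← Complex.exp_nat_mul]; congr 1; push_cast; ring
  rw [h2, h1]
  have h3 : ((1 / Real.sqrt (1 + q ^ 2) : ℝ) : ℂ) ^ 2 * (1 + q ^ 2) = 1 := by
    rw [← Complex.ofReal_pow, div_pow, Real.sq_sqrt (by positivity)]
    have : (1 + (q : ℂ) ^ 2) ≠ 0 := by
      have : (1 + q ^ 2 : ℝ) ≠ 0 := by positivity
      exact_mod_cast this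
    push_cast
    field_simp
  linear_combination (1 + Complex.I * q) * h3 -
    ((1 / Real.sqrt (1 + q ^ 2) : ℝ) : ℂ) ^ 2 * (1 + Complex.I * q) * q ^ 2 * Complex.I_sq

lemma exp_vv {t : ℝ} (ht : |t| < 1) (x : ℝ) :
    Complex.exp (Complex.I * (vv t x : ℝ)) * (1 - t * Complex.exp (Complex.I * x)) =
      Complex.exp (Complex.I * x) - t := by
  have h1 := den1_pos ht x
  have h1' : (1 - t * Real.cos x : ℂ) ≠ 0 := by exact_mod_cast h1.ne'
  have h2 := exp_arctan (t * Real.sin x / (1 - t * Real.cos x))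
  have h3 : Complex.exp (Complex.I * (2 * Real.arctan (t * Real.sin x / (1 - t * Real.cos x)) : ℝ)) *
      (1 - t * Real.cos x - Complex.I * (t * Real.sin x)) =
      (1 - t * Real.cos x + Complex.I * (t * Real.sin x)) := by
    generalize Complex.exp (Complex.I *
      (2 * Real.arctan (t * Real.sin x / (1 - t * Real.cos x)) : ℝ)) = E at h2 ⊢
    rw [Complex.ofReal_div, Complex.ofReal_sub, Complex.ofReal_mul, Complex.ofReal_mul,
      Complex.ofReal_one] at h2
    field_simp at h2
    linear_combination h2
  have h4 : Complex.exp (Complex.I * x) = Real.cos x + Complex.I * Real.sin x := by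
    rw [mul_comm, Complex.exp_mul_I, ← Complex.ofReal_cos, ← Complex.ofReal_sin]; ring
  have h5 : (Real.sin x : ℂ) ^ 2 + (Real.cos x : ℂ) ^ 2 = 1 := by
    exact_mod_cast Real.sin_sq_add_cos_sq x
  have h6 : Complex.exp (Complex.I * (vv t x : ℝ)) = Complex.exp (Complex.I * x) *
     Complex.exp (Complex.I * (2 * Real.arctan (t * Real.sin x / (1 - t * Real.cos x)) : ℝ)) := by
    rw [← Complex.exp_add, vv]; congr 1; push_cast; ring
  rw [h6]
  have h7 : (1 - t * Complex.exp (Complex.I * x)) =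
      (1 - t * Real.cos x - Complex.I * (t * Real.sin x)) := by rw [h4]; ring
  rw [h7, mul_assoc, h3, h4]
  linear_combination (-t : ℂ) * h5 + t * (Real.sin x : ℂ) ^ 2 * Complex.I_sq

end

section

variable (S : Setup V)

/-! ### Sums over roots -/

lemma t_neg {α : V} (h : α ∈ S.R0) : S.t (-α) = S.t α := by
  have := S.t_invariant α h α h
  rwa [← sr_apply, sr_self (S.ne_zero h)] at this

lemma sum_R0 {M : Type*} [AddCommMonoid M] (f : V → M) (hf : ∀ α ∈ S.R0, f (-α) = f α) :
    ∑ α ∈ S.R0, f α = ∑ α ∈ S.Rpos, f α + ∑ α ∈ S.Rpos, f α := by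
  rw [← Finset.sum_filter_add_sum_filter_not S.R0 (fun α => α ∈ S.Rpos)]
  congr 1
  · apply Finset.sum_congr _ (fun _ _ => rfl)
    ext α; simp only [Finset.mem_filter]
    exact ⟨fun h => h.2, fun h => ⟨S.pos_R h, h⟩⟩
  · refine Finset.sum_nbij' (fun α => -α) (fun α => -α) ?_ ?_ ?_ ?_ ?_
    · intro α h
      simp only [Finset.mem_filter] at h
      exact (S.pos_or_neg h.1).resolve_left h.2
    · intro α h
      simp only [Finset.mem_filter]
      exact ⟨S.neg_mem (S.pos_R h), S.not_neg_pos h⟩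
    · intro α _; simp
    · intro α _; simp
    · intro α h
      simp only [Finset.mem_filter] at h
      exact (hf α h.1).symm

lemma sum_sr {M : Type*} [AddCommMonoid M] (f : V → M) {β : V} (hβ : β ∈ S.R0) :
    ∑ α ∈ S.R0, f α = ∑ α ∈ S.R0, f (sr β α) := by
  refine Finset.sum_nbij' (fun α => sr β α) (fun α => sr β α) ?_ ?_ ?_ ?_ ?_
  · intro α h; exact S.sr_mem hβ h
  · intro α h; exact S.sr_mem hβ h
  · intro α _; exact sr_sr _ _
  · intro α _; exact sr_sr _ _
  · intro α _; rw [sr_sr]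

lemma rhoHat_sr (j : Fin S.n) : sr (S.simple j) S.rhoHat = S.rhoHat - S.hat (S.simple j) := by
  have h1 : ∑ α ∈ S.Rpos, S.hat (sr (S.simple j) α) =
      ∑ α ∈ S.Rpos, S.hat α - (2 : ℝ) • S.hat (S.simple j) := by
    rw [← Finset.add_sum_erase _ _ (S.simple_mem j),
      ← Finset.add_sum_erase S.Rpos (fun α => S.hat α) (S.simple_mem j),
      sr_self (S.ne_zero (S.simple_R j)), hat_neg]
    have : ∑ α ∈ S.Rpos.erase (S.simple j), S.hat (sr (S.simple j) α) =
        ∑ α ∈ S.Rpos.erase (S.simple j), S.hat α := by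
      have key : ∀ α ∈ S.Rpos.erase (S.simple j),
          sr (S.simple j) α ∈ S.Rpos.erase (S.simple j) := by
        intro α h
        rw [Finset.mem_erase] at h ⊢
        refine ⟨fun hc => ?_, S.simple_perm h.2 h.1⟩
        have h2 : α = -S.simple j := by
          rw [← sr_sr (S.simple j) α, hc, sr_self (S.ne_zero (S.simple_R j))]
        exact S.not_neg_pos (S.simple_mem j) (h2 ▸ h.2)
      refine Finset.sum_nbij' (fun α => sr (S.simple j) α) (fun α => sr (S.simple j) α) key key
        (fun α _ => sr_sr _ _) (fun α _ => sr_sr _ _) (fun α _ => rfl)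
    rw [this, two_smul]; abel
  simp only [hat_sr] at h1
  rw [rhoHat, map_smul, map_sum, h1, smul_sub, smul_smul]; norm_num

lemma rhoHat_simple (j : Fin S.n) : ⟪S.rhoHat, S.simple j⟫ = ⟪S.hat (S.simple j), S.simple j⟫ / 2 := by
  have h := sr_inner_left (S.simple j) S.rhoHat (S.simple j)
  rw [rhoHat_sr, sr_self (S.ne_zero (S.simple_R j)), inner_sub_left, inner_neg_right] at h
  linarith

lemma hat_self_pos {α : V} (h : α ∈ S.R0) : 0 < ⟪S.hat α, α⟫ := by
  rw [real_inner_comm, S.hat_pos h]; exact S.ipos h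

lemma rhoHat_pos {β : V} (h : β ∈ S.Rpos) : 0 < ⟪S.rhoHat, β⟫ := by
  have hd : S.Dom S.rhoHat := fun j => by
    rw [rhoHat_simple]; exact (half_pos (S.hat_self_pos (S.simple_R j))).le
  refine lt_of_le_of_ne (S.dom_nonneg hd h) fun hz => S.ne_zero (S.pos_R h) ?_
  rw [S.inner_eq_sum] at hz
  have := (Finset.sum_eq_zero_iff_of_nonneg
    (fun j _ => mul_nonneg (S.co_nonneg h j) (hd j))).mp hz.symm
  rw [← S.sum_co β]
  refine Finset.sum_eq_zero fun j hj => ?_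
  rcases mul_eq_zero.mp (this j hj) with h0 | h0
  · rw [h0, zero_smul]
  · rw [rhoHat_simple] at h0
    have := S.hat_self_pos (S.simple_R j)
    linarith

lemma rhoHat_Phat : S.rhoHat ∈ S.Phat := by
  have key : ∀ α ∈ S.Rpos, ∃ k : ℤ, ⟪S.rhoHat, coroot (S.hat α)⟫ = k := by
    refine S.pos_induct _ (fun i => ⟨1, ?_⟩) ?_
    · rw [S.coroot_hat (S.simple_R i), real_inner_smul_right, rhoHat_simple, m, real_inner_comm]
      have := S.hat_self_pos (S.simple_R i)
      field_simp; norm_num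
    · intro α hα i _ _ ih
      obtain ⟨k, hk⟩ := ih
      obtain ⟨l, hl⟩ := S.cryst_hat (S.simple_R i) (S.pos_R hα)
      rw [hat_sr, coroot_sr, ← sr_inner_left, rhoHat_sr, inner_sub_left, hl] at hk
      exact ⟨k + l, by push_cast; linarith⟩
  intro α hα
  rcases S.pos_or_neg hα with h | h
  · exact key α h
  · obtain ⟨k, hk⟩ := key _ h
    rw [hat_neg, coroot_neg, inner_neg_right] at hk
    exact ⟨-k, by push_cast; linarith⟩

/-! ### The critical equation -/

/-- The interaction part of the critical equation. -/
def FF (ξ : V) : V := ∑ α ∈ S.Rpos, vv (S.t α) ⟪ξ, α⟫ • S.hat α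

lemma FF_R0 (ξ : V) : ∑ α ∈ S.R0, vv (S.t α) ⟪ξ, α⟫ • S.hat α = S.FF ξ + S.FF ξ := by
  apply S.sum_R0
  intro α hα
  rw [S.t_neg hα, inner_neg_right, vv_neg, hat_neg, neg_smul_neg]

lemma crit {xi : V → V} (hxi : S.IsMinimizer xi) {μ : V} (hμ : μ ∈ S.Phat) (u : V) :
    S.c * ⟪xi μ, u⟫ + ⟪S.FF (xi μ), u⟫ = 2 * Real.pi * ⟪S.rhoHat + μ, u⟫ := by
  set ξ := xi μ with hξ
  have hmin : IsLocalMin (fun s : ℝ => S.Morse μ (ξ + s • u)) 0 := by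
    refine Filter.Eventually.of_forall fun s => ?_
    show S.Morse μ (ξ + (0 : ℝ) • u) ≤ S.Morse μ (ξ + s • u)
    rw [zero_smul, add_zero]
    by_cases h : ξ + s • u = ξ
    · rw [h]
    · exact (hxi μ hμ _ h).le
  have hd : HasDerivAt (fun s : ℝ => S.Morse μ (ξ + s • u))
      (S.c * ⟪ξ, u⟫ - 2 * Real.pi * ⟪S.rhoHat + μ, u⟫ +
        ∑ α ∈ S.Rpos, S.g α * (vv (S.t α) ⟪ξ, α⟫ * ⟪u, α⟫)) 0 := by
    unfold Morse MorseOf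
    refine HasDerivAt.add (HasDerivAt.sub ?_ ?_) ?_
    · have h1 : (fun s : ℝ => (S.c : ℝ) / 2 * ⟪ξ + s • u, ξ + s • u⟫) =
          fun s => (S.c : ℝ) / 2 * (⟪ξ, ξ⟫ + 2 * ⟪ξ, u⟫ * s + ⟪u, u⟫ * s ^ 2) := by
        funext s
        simp only [inner_add_left, inner_add_right, real_inner_smul_left, real_inner_smul_right]
        rw [real_inner_comm u ξ]; ring
      rw [h1]
      have h2 := (((hasDerivAt_id (0 : ℝ)).const_mul (2 * ⟪ξ, u⟫)).const_add ⟪ξ, ξ⟫).add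
        (((hasDerivAt_id (0 : ℝ)).pow 2).const_mul ⟪u, u⟫)
      refine (h2.const_mul ((S.c : ℝ) / 2)).congr_deriv ?_
      simp; ring
    · have h1 : (fun s : ℝ => 2 * Real.pi * ⟪S.rhoHat + μ, ξ + s • u⟫) =
          fun s => 2 * Real.pi * (⟪S.rhoHat + μ, ξ⟫ + ⟪S.rhoHat + μ, u⟫ * s) := by
        funext s
        rw [inner_add_right, real_inner_smul_right]; ring
      rw [h1]
      have h2 := ((hasDerivAt_id (0 : ℝ)).const_mul ⟪S.rhoHat + μ, u⟫).const_add ⟪S.rhoHat + μ, ξ⟫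
      exact (h2.const_mul (2 * Real.pi)).congr_deriv (by simp)
    · refine HasDerivAt.fun_sum fun α hα => ?_
      have hR := S.pos_R hα
      have hg : 2 / ⟪α, coroot (S.hat α)⟫ = S.g α := by
        have := S.g_pos hR
        have := S.ipos hR
        rw [S.coroot_hat hR, real_inner_smul_right, m_eq]; field_simp
      rw [hg]
      refine HasDerivAt.const_mul _ ?_
      have hv : vintOf S.t α = vv (S.t α) := funext fun x => vintOf_eq (S.t_bound α hR) x
      rw [hv]
      have h1 : HasDerivAt (fun s : ℝ => ⟪ξ + s • u, α⟫) ⟪u, α⟫ 0 := by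
        have h2 : (fun s : ℝ => ⟪ξ + s • u, α⟫) = fun s => ⟪ξ, α⟫ + ⟪u, α⟫ * s := by
          funext s
          rw [inner_add_left, real_inner_smul_left]; ring
        rw [h2]
        exact (((hasDerivAt_id (0 : ℝ)).const_mul ⟪u, α⟫).const_add ⟪ξ, α⟫).congr_deriv (by simp)
      have h3 := ((vv_cont (S.t_bound α hR)).integral_hasStrictDerivAt 0 ⟪ξ, α⟫).hasDerivAt
      have h4 : ⟪ξ, α⟫ = ⟪ξ + (0 : ℝ) • u, α⟫ := by simp
      rw [h4] at h3
      have h5 := HasDerivAt.comp (0 : ℝ) h3 h1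
      rw [← h4] at h5
      exact h5
  have h0 := hmin.hasDerivAt_eq_zero hd
  have h1 : ⟪S.FF ξ, u⟫ = ∑ α ∈ S.Rpos, S.g α * (vv (S.t α) ⟪ξ, α⟫ * ⟪u, α⟫) := by
    rw [FF, sum_inner]
    refine Finset.sum_congr rfl fun α _ => ?_
    rw [real_inner_smul_left, hat_eq, real_inner_smul_left, real_inner_comm u α]; ring
  rw [h1]; linarith

/-! ### Regularity -/

/-- Regular vectors. -/
def Reg (ξ : V) : Prop := ∀ α ∈ S.R0, ∀ k : ℤ, ⟪ξ, α⟫ ≠ k * (2 * Real.pi)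

lemma crit_reg {xi : V → V} (hxi : S.IsMinimizer xi) {μ : V} (hμ : μ ∈ S.Phatc) :
    S.Reg (xi μ) := by
  set ξ := xi μ with hξ
  have hpi := Real.pi_pos
  have key : ∀ β ∈ S.Rpos, ∀ k : ℤ, ⟪ξ, β⟫ ≠ k * (2 * Real.pi) := by
    intro β hβ k hk
    have hR := S.pos_R hβ
    have hcr := S.crit hxi hμ.1 β
    rw [← hξ, hk] at hcr
    set Y := ∑ α ∈ S.Rpos, ⟪α, coroot β⟫ * ⟪S.hat α, β⟫ with hY
    have hX : ∑ α ∈ S.R0, vv (S.t α) ⟪ξ, α⟫ * ⟪S.hat α, β⟫ = ⟪S.FF ξ, β⟫ + ⟪S.FF ξ, β⟫ := by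
      rw [← inner_add_left, ← FF_R0, sum_inner]
      simp only [real_inner_smul_left]
    have hY2 : ∑ α ∈ S.R0, ⟪α, coroot β⟫ * ⟪S.hat α, β⟫ = Y + Y := by
      apply S.sum_R0
      intro α _
      rw [hat_neg, inner_neg_left, inner_neg_left]; ring
    have hX2 : ∑ α ∈ S.R0, vv (S.t α) ⟪ξ, α⟫ * ⟪S.hat α, β⟫ =
        -(∑ α ∈ S.R0, vv (S.t α) ⟪ξ, α⟫ * ⟪S.hat α, β⟫) +
        k * (2 * Real.pi) * ∑ α ∈ S.R0, ⟪α, coroot β⟫ * ⟪S.hat α, β⟫ := by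
      conv_lhs => rw [S.sum_sr _ hR]
      rw [Finset.mul_sum, ← Finset.sum_neg_distrib, ← Finset.sum_add_distrib]
      refine Finset.sum_congr rfl fun α hα => ?_
      obtain ⟨a, ha⟩ := S.cryst β hR α hα
      have h1 : ⟪ξ, sr β α⟫ = ⟪ξ, α⟫ + ((-(a * k) : ℤ) : ℝ) * (2 * Real.pi) := by
        rw [sr_apply, inner_sub_right, real_inner_smul_right, hk, ha]; push_cast; ring
      have h2 : S.t (sr β α) = S.t α := S.t_invariant β hR α hα
      rw [h1, h2, vv_add, hat_sr, sr_inner_left, sr_self (S.ne_zero hR), inner_neg_right, ha]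
      push_cast; ring
    rw [hX, hY2] at hX2
    have hF : ⟪S.FF ξ, β⟫ = k * Real.pi * Y := by linarith
    have hmain : 2 * ⟪S.rhoHat + μ, β⟫ = k * (2 * S.c + Y) := by
      rw [hF] at hcr
      have : Real.pi * (2 * ⟪S.rhoHat + μ, β⟫) = Real.pi * (k * (2 * S.c + Y)) := by
        linarith
      exact mul_left_cancel₀ hpi.ne' this
    have hrho : 2 * ⟪S.rhoHat, β⟫ = ∑ α ∈ S.Rpos, ⟪S.hat α, β⟫ := by
      rw [rhoHat, real_inner_smul_left, sum_inner]; ring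
    have hlt : 2 * ⟪S.rhoHat, β⟫ < Y := by
      rw [hrho]
      refine Finset.sum_lt_sum ?_ ⟨β, hβ, ?_⟩
      · intro α hα
        obtain ⟨a, ha⟩ := S.cryst β hR α (S.pos_R hα)
        have hg := S.g_pos (S.pos_R hα)
        have hi := S.ipos hR
        have h1 : ⟪S.hat α, β⟫ = S.g α * (a * ⟪β, β⟫ / 2) := by
          rw [← ha, hat_eq, real_inner_smul_left, inner_coroot]; field_simp
        rw [h1, ha]
        have h2 : 0 ≤ ((a : ℝ) - 1) * a := by
          have : 0 ≤ (a - 1) * a := by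
            rcases le_or_gt a 0 with h | h
            · nlinarith
            · exact mul_nonneg (by omega) (by omega)
          exact_mod_cast this
        have h3 : 0 ≤ ((a : ℝ) - 1) * a * (S.g α * ⟪β, β⟫ / 2) :=
          mul_nonneg h2 (by positivity)
        linarith
      · rw [inner_coroot_self (S.ne_zero hR)]
        have := S.hat_self_pos hR
        linarith
    have h0 := S.rhoHat_pos hβ
    obtain ⟨h1, h2⟩ := hμ.2 β hβ
    rw [inner_add_left] at hmain
    have hc := S.c_pos
    have hD : 0 < 2 * S.c + Y := by linarith
    have hk0 : (0 : ℝ) < k := by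
      by_contra hn
      push Not at hn
      have := mul_nonneg (neg_nonneg.mpr hn) hD.le
      linarith
    have hk1 : (k : ℝ) < 1 := by
      by_contra hn
      push Not at hn
      have := mul_le_mul_of_nonneg_right hn hD.le
      linarith
    have : 0 < k := by exact_mod_cast hk0
    have : k < 1 := by exact_mod_cast hk1
    omega
  intro α hα k
  rcases S.pos_or_neg hα with h | h
  · exact key α h k
  · have := key _ h (-k)
    rw [inner_neg_right] at this
    intro hc
    apply this
    rw [hc]; push_cast; ring

end

section

variable (S : Setup V)

/-! ### The finite Weyl group -/

lemma W0_lin {w : Equiv.Perm V} (hw : w ∈ S.W0) :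
    ∃ L : V →ₗ[ℝ] V, (∀ x, w x = L x) ∧ (∀ x y, ⟪L x, L y⟫ = ⟪x, y⟫) ∧
      ∀ α ∈ S.R0, L α ∈ S.R0 ∧ S.t (L α) = S.t α := by
  have key : ∀ l : List (Fin S.n), ∀ w : Equiv.Perm V,
      w = (l.map fun j => reflP (S.simple j) 0).prod →
      ∃ L : V →ₗ[ℝ] V, (∀ x, w x = L x) ∧ (∀ x y, ⟪L x, L y⟫ = ⟪x, y⟫) ∧
      ∀ α ∈ S.R0, L α ∈ S.R0 ∧ S.t (L α) = S.t α := by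
    intro l
    induction l with
    | nil =>
      rintro w rfl
      exact ⟨LinearMap.id, fun x => rfl, fun x y => rfl, fun α hα => ⟨hα, rfl⟩⟩
    | cons j l ih =>
      rintro w rfl
      obtain ⟨L, h1, h2, h3⟩ := ih _ rfl
      refine ⟨(sr (S.simple j)).comp L, fun x => ?_, fun x y => ?_, fun α hα => ⟨?_, ?_⟩⟩
      · rw [List.map_cons, List.prod_cons, Equiv.Perm.mul_apply, h1, reflP_zero]; rfl
      · rw [LinearMap.comp_apply, LinearMap.comp_apply, sr_inner, h2]
      · exact S.sr_mem (S.simple_R j) (h3 α hα).1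
      · rw [← (h3 α hα).2]
        exact S.t_invariant _ (S.simple_R j) _ (h3 α hα).1
  have hw' := S.W0_le hw
  have hword : ∀ w ∈ Subgroup.closure (Set.range fun i : Fin S.n => S.sgen i.succ),
      ∃ l : List (Fin S.n), w = (l.map fun j => reflP (S.simple j) 0).prod := by
    intro w hw
    refine Subgroup.closure_induction (p := fun w _ => ∃ l : List (Fin S.n),
      w = (l.map fun j => reflP (S.simple j) 0).prod) ?_ ?_ ?_ ?_ hw
    · rintro _ ⟨j, rfl⟩; exact ⟨[j], by simp [sgen_succ]⟩
    · exact ⟨[], rfl⟩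
    · rintro _ _ _ _ ⟨l, rfl⟩ ⟨l', rfl⟩; exact ⟨l ++ l', by simp⟩
    · rintro _ _ ⟨l, rfl⟩
      refine ⟨l.reverse, ?_⟩
      clear * -
      induction l with
      | nil => simp
      | cons j l ih =>
        have hi : (reflP (S.simple j) 0)⁻¹ = reflP (S.simple j) 0 := by
          rw [← sgen_succ, sgen_inv]
        rw [List.map_cons, List.prod_cons, mul_inv_rev, ih, hi]
        simp
  obtain ⟨l, hl⟩ := hword w hw'
  exact key l w hl

/-- The linear map of an element of `W₀`. -/
def lin (w : ↥S.W0) : V →ₗ[ℝ] V := (S.W0_lin w.2).choose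

lemma lin_apply (w : ↥S.W0) (x : V) : w.1 x = S.lin w x := (S.W0_lin w.2).choose_spec.1 x

lemma lin_inner (w : ↥S.W0) (x y : V) : ⟪S.lin w x, S.lin w y⟫ = ⟪x, y⟫ :=
  (S.W0_lin w.2).choose_spec.2.1 x y

lemma lin_R (w : ↥S.W0) {α : V} (h : α ∈ S.R0) : S.lin w α ∈ S.R0 :=
  ((S.W0_lin w.2).choose_spec.2.2 α h).1

lemma lin_t (w : ↥S.W0) {α : V} (h : α ∈ S.R0) : S.t (S.lin w α) = S.t α :=
  ((S.W0_lin w.2).choose_spec.2.2 α h).2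

lemma lin_mul (w w' : ↥S.W0) (x : V) : S.lin (w * w') x = S.lin w (S.lin w' x) := by
  rw [← lin_apply, ← lin_apply, ← lin_apply]; rfl

lemma lin_one (x : V) : S.lin 1 x = x := by rw [← lin_apply]; rfl

lemma lin_inv (w : ↥S.W0) (x : V) : S.lin w⁻¹ (S.lin w x) = x := by
  rw [← lin_mul, inv_mul_cancel, lin_one]

lemma lin_inv' (w : ↥S.W0) (x : V) : S.lin w (S.lin w⁻¹ x) = x := by
  rw [← lin_mul, mul_inv_cancel, lin_one]

lemma lin_inner_left (w : ↥S.W0) (x y : V) : ⟪S.lin w x, y⟫ = ⟪x, S.lin w⁻¹ y⟫ := by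
  rw [← S.lin_inner w x, lin_inv']

lemma lin_hat (w : ↥S.W0) (α : V) : S.hat (S.lin w α) = S.lin w (S.hat α) := by
  rw [hat_eq, hat_eq, map_smul]
  unfold g; rw [lin_inner]

lemma lin_ext {w w' : ↥S.W0} (h : ∀ α ∈ S.R0, S.lin w α = S.lin w' α) : w = w' := by
  have : S.lin w = S.lin w' := by
    apply LinearMap.ext_on (s := (S.R0 : Set V)) S.span_top
    intro α hα
    exact h α hα
  apply Subtype.ext
  ext x
  rw [lin_apply, lin_apply, this]

instance W0_finite : Finite ↥S.W0 := by
  refine Finite.of_injective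
    (fun (w : ↥S.W0) (α : ↥S.R0) => (⟨S.lin w α.1, S.lin_R w α.2⟩ : ↥S.R0)) ?_
  intro w w' h
  apply S.lin_ext
  intro α hα
  exact congrArg Subtype.val (congrFun h ⟨α, hα⟩)

instance W0_fintype : Fintype ↥S.W0 := Fintype.ofFinite _

/-- The linear part of the simple affine reflections. -/
def sg (j : Fin (S.n + 1)) : ↥S.W0 :=
  ⟨reflP (S.alpha j) 0, Subgroup.subset_closure ⟨_, S.alpha_R j, rfl⟩⟩

lemma lin_sg (j : Fin (S.n + 1)) (x : V) : S.lin (S.sg j) x = sr (S.alpha j) x := by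
  rw [← lin_apply, ← reflP_zero]; rfl

lemma sg_sg (j : Fin (S.n + 1)) : S.sg j * S.sg j = 1 := by
  apply S.lin_ext
  intro α _
  rw [lin_mul, lin_sg, lin_sg, sr_sr, lin_one]

lemma sg_sg_mul (j : Fin (S.n + 1)) (w : ↥S.W0) : S.sg j * (S.sg j * w) = w := by
  rw [← mul_assoc, sg_sg, one_mul]

variable {S} in
lemma Reg.lin {ξ : V} (h : S.Reg ξ) (w : ↥S.W0) : S.Reg (S.lin w ξ) := by
  intro α hα k
  rw [lin_inner_left]
  exact h _ (S.lin_R _ hα) k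

/-! ### Action of `T_j` on plane waves -/

/-- The exponential `e^{-i⟨α_j, η⟩}`. -/
def zz (j : Fin (S.n + 1)) (η : V) : ℂ := Complex.exp (-(Complex.I * (⟪S.alpha j, η⟫ : ℝ)))

/-- The exponential `e^{-i k_j ⟨α_j, η⟩}`. -/
def kz (j : Fin (S.n + 1)) (η : V) : ℂ :=
  Complex.exp (-(Complex.I * (S.kconst j * ⟪S.alpha j, η⟫ : ℝ)))

lemma zz_ne_zero (j : Fin (S.n + 1)) (η : V) : S.zz j η ≠ 0 := Complex.exp_ne_zero _

lemma kz_ne_zero (j : Fin (S.n + 1)) (η : V) : S.kz j η ≠ 0 := Complex.exp_ne_zero _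

lemma exp_ne_one {x : ℝ} (h : ∀ k : ℤ, x ≠ k * (2 * Real.pi)) :
    Complex.exp (Complex.I * (x : ℂ)) ≠ 1 := by
  intro hc
  obtain ⟨n, hn⟩ := Complex.exp_eq_one_iff.mp hc
  apply h n
  have : Complex.I * (x : ℂ) = Complex.I * (n * (2 * Real.pi)) := by rw [hn]; ring
  have := mul_left_cancel₀ Complex.I_ne_zero this
  exact_mod_cast this

lemma exp_one_of {x : ℝ} {k : ℤ} (h : x = k * (2 * Real.pi)) :
    Complex.exp (Complex.I * (x : ℂ)) = 1 := by
  rw [Complex.exp_eq_one_iff]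
  exact ⟨k, by rw [h]; push_cast; ring⟩

lemma zz_ne_one (j : Fin (S.n + 1)) {η : V} (h : S.Reg η) : S.zz j η ≠ 1 := by
  have h1 := exp_ne_one (x := ⟪η, -S.alpha j⟫) (h _ (S.neg_mem (S.alpha_R j)))
  rw [zz]
  convert h1 using 2
  rw [inner_neg_right, real_inner_comm]; push_cast; ring

lemma zz_sr (j : Fin (S.n + 1)) (η : V) : S.zz j (sr (S.alpha j) η) = (S.zz j η)⁻¹ := by
  rw [zz, zz, ← sr_inner_left, sr_self (S.ne_zero (S.alpha_R j)), inner_neg_left, ← Complex.exp_neg]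
  push_cast; congr 1; ring

lemma kz_sr (j : Fin (S.n + 1)) (η : V) : S.kz j (sr (S.alpha j) η) = (S.kz j η)⁻¹ := by
  rw [kz, kz, ← sr_inner_left, sr_self (S.ne_zero (S.alpha_R j)), inner_neg_left, ← Complex.exp_neg]
  push_cast; congr 1; ring

lemma geom1 {z : ℂ} (h1 : z ≠ 1) (n : ℕ) :
    ∑ k ∈ Finset.Icc (1 : ℤ) n, z ^ k = z * (1 - z ^ (n : ℤ)) / (1 - z) := by
  have h2 : 1 - z ≠ 0 := sub_ne_zero.mpr h1.symm
  induction n with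
  | zero => simp
  | succ n ih =>
    have : Finset.Icc (1 : ℤ) ((n + 1 : ℕ) : ℤ) = insert ((n + 1 : ℕ) : ℤ) (Finset.Icc 1 (n : ℤ)) := by
      ext k; simp only [Finset.mem_Icc, Finset.mem_insert]; omega
    rw [this, Finset.sum_insert (by simp), ih, zpow_natCast, zpow_natCast]
    field_simp
    ring

lemma geom2 {z : ℂ} (h0 : z ≠ 0) (h1 : z ≠ 1) (n : ℕ) :
    ∑ k ∈ Finset.Icc (0 : ℤ) ((n : ℤ) - 1), z ^ (-k) = -(z * (1 - z ^ (-(n : ℤ))) / (1 - z)) := by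
  have h2 : 1 - z ≠ 0 := sub_ne_zero.mpr h1.symm
  induction n with
  | zero => simp
  | succ n ih =>
    have : Finset.Icc (0 : ℤ) (((n + 1 : ℕ) : ℤ) - 1) =
        insert (n : ℤ) (Finset.Icc 0 ((n : ℤ) - 1)) := by
      ext k; simp only [Finset.mem_Icc, Finset.mem_insert]; omega
    rw [this, Finset.sum_insert (by simp), ih, zpow_neg, zpow_neg, zpow_natCast, zpow_natCast,
      pow_succ]
    field_simp
    ring

lemma pw_shift (j : Fin (S.n + 1)) (η : V) (x : V) (k : ℤ) :
    Complex.exp (Complex.I * (⟪x - (k : ℝ) • S.alpha j, η⟫ : ℝ)) =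
      Complex.exp (Complex.I * (⟪x, η⟫ : ℝ)) * S.zz j η ^ k := by
  rw [zz, ← Complex.exp_int_mul, ← Complex.exp_add, inner_sub_left, real_inner_smul_left]
  congr 1; push_cast; ring

/-- Reflection coefficient. -/
def Aj (j : Fin (S.n + 1)) (η : V) : ℂ :=
  S.kz j η * (S.t (S.alpha j) - S.zz j η) / (1 - S.zz j η)

/-- Transmission coefficient. -/
def Bj (j : Fin (S.n + 1)) (η : V) : ℂ :=
  (1 - S.t (S.alpha j)) * S.zz j η / (1 - S.zz j η)

lemma TL_pw (j : Fin (S.n + 1)) {η : V} (h : S.Reg η) :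
    S.TL j (S.planewave η) =
      S.Aj j η • S.planewave (sr (S.alpha j) η) + S.Bj j η • S.planewave η := by
  have h1 := S.zz_ne_one j h
  have h0 := S.zz_ne_zero j η
  have h2 : 1 - S.zz j η ≠ 0 := sub_ne_zero.mpr h1.symm
  funext x
  obtain ⟨a, ha⟩ := S.aFun_int j x.2
  have hev : ∀ k : ℤ, S.ev (S.planewave η) (x.1 - (k : ℝ) • S.alpha j) =
      Complex.exp (Complex.I * (⟪x.1, η⟫ : ℝ)) * S.zz j η ^ k := by
    intro k
    rw [S.ev_mem _ (S.PG.sub_mem x.2 (S.zsmul_PG (S.root_PG (S.alpha_R j)) k)), ← pw_shift]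
    rfl
  have hev' : ∀ k : ℤ, S.ev (S.planewave η) (x.1 + (k : ℝ) • S.alpha j) =
      Complex.exp (Complex.I * (⟪x.1, η⟫ : ℝ)) * S.zz j η ^ (-k) := by
    intro k
    rw [← hev]; congr 1; push_cast; rw [neg_smul, sub_neg_eq_add]
  have hJ : S.Jop j (S.planewave η) x = -(Complex.exp (Complex.I * (⟪x.1, η⟫ : ℝ)) *
      (S.zz j η * (1 - S.zz j η ^ a) / (1 - S.zz j η))) := by
    rw [Jop, ha, Int.floor_intCast]
    split_ifs with ha1 ha2
    · obtain ⟨n, rfl⟩ := Int.eq_ofNat_of_zero_le ha1.le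
      simp only [hev]
      rw [← Finset.mul_sum]
      rw [geom1 h1]
    · obtain ⟨n, hn⟩ := Int.eq_ofNat_of_zero_le (neg_nonneg.mpr ha2.le)
      simp only [hev']
      rw [← Finset.mul_sum, hn, geom2 h0 h1, ← hn, neg_neg]; ring
    · have : a = 0 := by omega
      rw [this]; simp
  have hs : S.ev (S.planewave η) ((S.sgen j)⁻¹ x.1) =
      Complex.exp (Complex.I * (⟪x.1, η⟫ : ℝ)) * S.zz j η ^ a := by
    rw [sgen_inv, sgen_eq', ha, hev]
  have hs' : S.kz j η * S.planewave (sr (S.alpha j) η) x =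
      Complex.exp (Complex.I * (⟪x.1, η⟫ : ℝ)) * S.zz j η ^ a := by
    rw [← pw_shift, ← ha, ← sgen_eq', sgen_eq, planewave, kz, ← Complex.exp_add, inner_sub_left,
      real_inner_smul_left, sr_inner_left]
    congr 1; push_cast; ring
  have hp : S.planewave η x = Complex.exp (Complex.I * (⟪x.1, η⟫ : ℝ)) := rfl
  rw [TL_apply, Top, hs, hJ]
  show _ = S.Aj j η * _ + S.Bj j η * _
  have hA : S.Aj j η * S.planewave (sr (S.alpha j) η) x =
      (S.t (S.alpha j) - S.zz j η) / (1 - S.zz j η) *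
        (S.kz j η * S.planewave (sr (S.alpha j) η) x) := by rw [Aj]; ring
  rw [hA, hs', hp, Bj]
  field_simp
  ring

/-! ### Coefficient functions -/

/-- Combination of plane waves. -/
def EE (ξ : V) (b : ↥S.W0 → ℂ) : ↥S.Plat → ℂ := ∑ w : ↥S.W0, b w • S.planewave (S.lin w ξ)

/-- The action of `T_j` on coefficients. -/
def Tt (j : Fin (S.n + 1)) (ξ : V) (b : ↥S.W0 → ℂ) (w : ↥S.W0) : ℂ :=
  b w * S.Bj j (S.lin w ξ) + b (S.sg j * w) * S.Aj j (S.lin (S.sg j * w) ξ)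

lemma TL_EE (j : Fin (S.n + 1)) {ξ : V} (h : S.Reg ξ) (b : ↥S.W0 → ℂ) :
    S.TL j (S.EE ξ b) = S.EE ξ (S.Tt j ξ b) := by
  have h1 : ∀ w : ↥S.W0, S.TL j (b w • S.planewave (S.lin w ξ)) =
      (b w * S.Aj j (S.lin w ξ)) • S.planewave (S.lin (S.sg j * w) ξ) +
      (b w * S.Bj j (S.lin w ξ)) • S.planewave (S.lin w ξ) := by
    intro w
    rw [map_smul, S.TL_pw j (h.lin w), smul_add, smul_smul, smul_smul, lin_mul, lin_sg]
  rw [EE, map_sum]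
  simp only [h1]
  rw [Finset.sum_add_distrib, EE]
  simp only [Tt, add_smul]
  rw [Finset.sum_add_distrib, add_comm]
  congr 1
  refine Fintype.sum_equiv (Equiv.mulLeft (S.sg j)) _ _ fun w => ?_
  simp only [Equiv.coe_mulLeft, sg_sg_mul]

lemma Tt_eq (j : Fin (S.n + 1)) {ξ : V} (h : S.Reg ξ) (b : ↥S.W0 → ℂ) (w : ↥S.W0) :
    S.Tt j ξ b w * (1 - S.zz j (S.lin w ξ)) =
      b w * ((1 - S.t (S.alpha j)) * S.zz j (S.lin w ξ)) + b (S.sg j * w) *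
        ((S.kz j (S.lin w ξ))⁻¹ * (1 - S.t (S.alpha j) * S.zz j (S.lin w ξ))) := by
  have h1 := S.zz_ne_one j (h.lin w)
  have h0 := S.zz_ne_zero j (S.lin w ξ)
  have hk := S.kz_ne_zero j (S.lin w ξ)
  have h2 : 1 - S.zz j (S.lin w ξ) ≠ 0 := sub_ne_zero.mpr h1.symm
  have h3 : S.zz j (S.lin w ξ) - 1 ≠ 0 := sub_ne_zero.mpr h1
  have hA : S.Aj j (sr (S.alpha j) (S.lin w ξ)) * (1 - S.zz j (S.lin w ξ)) =
      (S.kz j (S.lin w ξ))⁻¹ * (1 - S.t (S.alpha j) * S.zz j (S.lin w ξ)) := by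
    rw [Aj, zz_sr, kz_sr]
    field_simp
    ring
  rw [Tt, lin_mul, lin_sg, Bj, add_mul, mul_assoc (b (S.sg j * w)), hA]
  field_simp

/-- The eigenvalue condition in terms of coefficients. -/
lemma Tt_eig (j : Fin (S.n + 1)) {ξ : V} (h : S.Reg ξ) (b : ↥S.W0 → ℂ) (w : ↥S.W0) :
    S.Tt j ξ b w = S.t (S.alpha j) * b w ↔
      b w * (S.t (S.alpha j) - S.zz j (S.lin w ξ)) = b (S.sg j * w) *
        ((S.kz j (S.lin w ξ))⁻¹ * (1 - S.t (S.alpha j) * S.zz j (S.lin w ξ))) := by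
  have h1 := S.zz_ne_one j (h.lin w)
  have h2 : 1 - S.zz j (S.lin w ξ) ≠ 0 := sub_ne_zero.mpr h1.symm
  have h3 := S.Tt_eq j h b w
  constructor
  · intro he
    rw [he] at h3
    linear_combination h3
  · intro he
    apply mul_right_cancel₀ h2
    rw [h3, ← he]; ring

/-- The quadratic relation. -/
lemma Tt_quad (j : Fin (S.n + 1)) {ξ : V} (h : S.Reg ξ) (b : ↥S.W0 → ℂ) (w : ↥S.W0) :
    S.Tt j ξ (fun w => S.Tt j ξ b w + b w) w =
      S.t (S.alpha j) * (S.Tt j ξ b w + b w) := by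
  rw [S.Tt_eig j h]
  have h1 := S.zz_ne_one j (h.lin w)
  have h0 := S.zz_ne_zero j (S.lin w ξ)
  have hk := S.kz_ne_zero j (S.lin w ξ)
  have h2 : 1 - S.zz j (S.lin w ξ) ≠ 0 := sub_ne_zero.mpr h1.symm
  have e1 := S.Tt_eq j h b w
  have e2 := S.Tt_eq j h b (S.sg j * w)
  rw [sg_sg_mul, lin_mul, lin_sg, zz_sr, kz_sr, inv_inv] at e2
  set z := S.zz j (S.lin w ξ)
  set κ := S.kz j (S.lin w ξ)
  set t : ℂ := (S.t (S.alpha j) : ℂ)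
  have e2' : S.Tt j ξ b (S.sg j * w) * (z - 1) = b (S.sg j * w) * (1 - t) + b w * (κ * (z - t)) := by
    field_simp at e2
    linear_combination e2
  have e1' : κ * (S.Tt j ξ b w * (1 - z)) =
    κ * (b w * ((1 - t) * z)) + b (S.sg j * w) * (1 - t * z) := by
    rw [e1]; field_simp
  apply mul_right_cancel₀ (mul_ne_zero h2 hk)
  have hκ : κ⁻¹ * κ = 1 := inv_mul_cancel₀ hk
  linear_combination (t - z) * e1' + (1 - t * z) * e2' -
    (S.Tt j ξ b (S.sg j * w) + b (S.sg j * w)) * (1 - t * z) * (1 - z) * hκ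

end

section

variable (S : Setup V)

/-! ### Parity of the length -/

lemma det_sr {α : V} (h : α ≠ 0) : LinearMap.det (sr α) = -1 := by
  have : sr α = LinearMap.transvection (-(innerₗ V (coroot α))) α := by
    ext x
    rw [LinearMap.transvection.apply, sr_apply, LinearMap.neg_apply, innerₗ_apply_apply, neg_smul,
      real_inner_comm, sub_eq_add_neg]
  rw [this, LinearMap.transvection.det, LinearMap.neg_apply, innerₗ_apply_apply, real_inner_comm,
    inner_coroot_self h]
  norm_num

lemma wp_det (l : List (Fin (S.n + 1))) : ∃ L : V →ₗ[ℝ] V, (∀ x, S.wp l x = L x + S.wp l 0) ∧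
    LinearMap.det L = (-1) ^ l.length := by
  induction l with
  | nil => exact ⟨LinearMap.id, fun x => by simp [wp_nil], by simp⟩
  | cons j l ih =>
    obtain ⟨L, h1, h2⟩ := ih
    refine ⟨(sr (S.alpha j)).comp L, fun x => ?_, ?_⟩
    · rw [wp_cons, Equiv.Perm.mul_apply, Equiv.Perm.mul_apply, sgen_eq, sgen_eq, h1, map_add]
      simp only [LinearMap.comp_apply]
      abel
    · rw [LinearMap.det_comp, h2, det_sr (S.ne_zero (S.alpha_R j)), List.length_cons, pow_succ]
      ring

lemma wp_parity {l l' : List (Fin (S.n + 1))} (h : S.wp l = S.wp l') :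
    ((-1) ^ l.length : ℝ) = (-1) ^ l'.length := by
  obtain ⟨L, h1, h2⟩ := S.wp_det l
  obtain ⟨L', h1', h2'⟩ := S.wp_det l'
  have : L = L' := by
    ext x
    have h3 := h1 x
    rw [h, h1' x] at h3
    exact (add_right_cancel h3).symm
  rw [← h2, ← h2', this]

lemma red_cons {w : Equiv.Perm V} {l l' : List (Fin (S.n + 1))} (j : Fin (S.n + 1))
    (hl : S.IsReducedWord l w) (hl' : S.IsReducedWord l' (S.sgen j * w)) :
    S.IsReducedWord (j :: l) (S.sgen j * w) ∨ S.IsReducedWord (j :: l') w := by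
  have e1 : S.wp l = w := hl.1
  have e2 : S.wp l' = S.sgen j * w := hl'.1
  have a1 : S.wp (j :: l) = S.sgen j * w := by rw [wp_cons, e1]
  have a2 : S.wp (j :: l') = w := by rw [wp_cons, e2, ← mul_assoc, sgen_mul, one_mul]
  have b1 := S.len_le (j :: l)
  have b2 := S.len_le (j :: l')
  rw [a1, ← hl'.2, List.length_cons] at b1
  rw [a2, ← hl.2, List.length_cons] at b2
  have hp := S.wp_parity (a1.trans e2.symm)
  have hne : l.length ≠ l'.length := by
    intro hc
    rw [List.length_cons, hc, pow_succ] at hp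
    rcases neg_one_pow_eq_or ℝ l'.length with h | h <;> rw [h] at hp <;> norm_num at hp
  rcases lt_or_gt_of_ne hne with h | h
  · left; exact ⟨a1, by rw [← hl'.2, List.length_cons]; omega⟩
  · right; exact ⟨a2, by rw [← hl.2, List.length_cons]; omega⟩

/-! ### Symmetrizer -/

/-- Coefficients of `T_{j₁} ⋯ T_{j_ℓ} e^{iξ}`. -/
def bw (ξ : V) : List (Fin (S.n + 1)) → ↥S.W0 → ℂ
  | [] => Pi.single 1 1
  | j :: l => S.Tt j ξ (bw ξ l)

lemma wordOp_pw {ξ : V} (h : S.Reg ξ) (l : List (Fin (S.n + 1))) :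
    S.wordOp l (S.planewave ξ) = S.EE ξ (S.bw ξ l) := by
  induction l with
  | nil =>
    show S.planewave ξ = _
    rw [EE, Finset.sum_eq_single 1]
    · simp [bw, lin_one]
    · intro w _ hw; simp [bw, hw]
    · intro h; exact absurd (Finset.mem_univ _) h
  | cons j l ih => rw [wordOp_cons, ih, S.TL_EE j h]; rfl

/-- A chosen reduced word. -/
def rword (v : ↥S.W0) : List (Fin (S.n + 1)) := (S.exists_red (S.W0_le_W v.2)).choose

lemma rword_red (v : ↥S.W0) : S.IsReducedWord (S.rword v) v.1 :=
  (S.exists_red (S.W0_le_W v.2)).choose_spec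

/-- Coefficients of `φ_ξ`. -/
def bphi (ξ : V) (w : ↥S.W0) : ℂ := ∑ v : ↥S.W0, S.bw ξ (S.rword v) w

variable {S} in
lemma phi_eq {TW : Equiv.Perm V → (↥S.Plat → ℂ) → (↥S.Plat → ℂ)} (ξ : V) :
    S.phiW TW ξ = ∑ v : ↥S.W0, TW v.1 (S.planewave ξ) := by
  rw [phiW, ← finsum_set_coe_eq_finsum_mem]
  exact @finsum_eq_sum_of_fintype _ _ _ (S.W0_fintype) _

variable {S} in
lemma phi_EE {TW : Equiv.Perm V → (↥S.Plat → ℂ) → (↥S.Plat → ℂ)} (hTW : S.IsTW TW) {ξ : V}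
    (h : S.Reg ξ) : S.phiW TW ξ = S.EE ξ (S.bphi ξ) := by
  rw [phi_eq]
  simp only [fun v : ↥S.W0 => hTW v.1 _ (S.rword_red v), S.wordOp_pw h]
  simp only [EE, bphi, Finset.sum_smul]
  exact Finset.sum_comm

lemma sg_succ (i : Fin S.n) (v : ↥S.W0) : (S.sg i.succ * v).1 = S.sgen i.succ * v.1 := by
  rw [sgen_succ]
  show reflP (S.alpha i.succ) 0 * v.1 = _
  rw [alpha_succ]

lemma EE_add (ξ : V) (b b' : ↥S.W0 → ℂ) : S.EE ξ (fun w => b w + b' w) = S.EE ξ b + S.EE ξ b' := by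
  simp only [EE, add_smul, Finset.sum_add_distrib]

lemma EE_smul (ξ : V) (r : ℂ) (b : ↥S.W0 → ℂ) : S.EE ξ (fun w => r * b w) = r • S.EE ξ b := by
  simp only [EE, Finset.smul_sum, smul_smul]

lemma quad_word {ξ : V} (h : S.Reg ξ) (j : Fin (S.n + 1)) (l : List (Fin (S.n + 1))) :
    S.TL j (S.wordOp (j :: l) (S.planewave ξ) + S.wordOp l (S.planewave ξ)) =
      (S.t (S.alpha j) : ℂ) • (S.wordOp (j :: l) (S.planewave ξ) + S.wordOp l (S.planewave ξ)) := by
  rw [S.wordOp_pw h, S.wordOp_pw h, ← EE_add, S.TL_EE j h, ← EE_smul]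
  congr 1
  funext w
  exact S.Tt_quad j h (S.bw ξ l) w

variable {S} in
lemma phi_eig {TW : Equiv.Perm V → (↥S.Plat → ℂ) → (↥S.Plat → ℂ)} (hTW : S.IsTW TW) {ξ : V}
    (h : S.Reg ξ) (i : Fin S.n) :
    S.TL i.succ (S.phiW TW ξ) = (S.t (S.alpha i.succ) : ℂ) • S.phiW TW ξ := by
  rw [← sub_eq_zero, phi_eq, map_sum, Finset.smul_sum, ← Finset.sum_sub_distrib]
  have hpair : ∀ v : ↥S.W0, S.TL i.succ (TW v.1 (S.planewave ξ) +
      TW (S.sg i.succ * v).1 (S.planewave ξ)) = (S.t (S.alpha i.succ) : ℂ) •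
      (TW v.1 (S.planewave ξ) + TW (S.sg i.succ * v).1 (S.planewave ξ)) := by
    intro v
    have r1 := S.rword_red v
    have r2 := S.rword_red (S.sg i.succ * v)
    rw [sg_succ] at r2 ⊢
    rcases S.red_cons i.succ r1 r2 with h3 | h3
    · rw [hTW _ _ h3, hTW _ _ r1, add_comm]
      exact S.quad_word h _ _
    · rw [hTW _ _ r2, hTW _ _ h3]
      exact S.quad_word h _ _
  refine Finset.sum_involution (fun v _ => S.sg i.succ * v) ?_ ?_ ?_ ?_
  · intro v _
    have := hpair v
    rw [map_add, smul_add] at this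
    rw [sub_add_sub_comm, this, sub_self]
  · intro v _ _ hc
    have h1 : S.sg i.succ = 1 := mul_eq_right.mp hc
    have h2 := S.lin_sg i.succ (S.alpha i.succ)
    rw [h1, lin_one, sr_self (S.ne_zero (S.alpha_R _))] at h2
    have h3 := congrArg (fun x => ⟪x, S.alpha i.succ⟫) h2
    simp only [inner_neg_left] at h3
    linarith [S.ipos (S.alpha_R i.succ)]
  · intro v _; exact Finset.mem_univ _
  · intro v _; exact S.sg_sg_mul _ _

end

section

variable (S : Setup V)

/-! ### Independence of plane waves and perturbation -/

/-- The plane wave as a character. -/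
def chr (η : V) : Multiplicative ↥S.PG →* ℂ where
  toFun x := Complex.exp (Complex.I * (⟪(Multiplicative.toAdd x).1, η⟫ : ℝ))
  map_one' := by simp
  map_mul' x y := by
    rw [← Complex.exp_add, toAdd_mul, AddSubgroup.coe_add, inner_add_left]
    congr 1; push_cast; ring

/-- Distinct characters. -/
def Gen (ξ : V) : Prop := ∀ w w' : ↥S.W0, w ≠ w' → ∃ α ∈ S.R0,
  Complex.exp (Complex.I * (⟪α, S.lin w ξ⟫ : ℝ)) ≠ Complex.exp (Complex.I * (⟪α, S.lin w' ξ⟫ : ℝ))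

variable {S} in
lemma Gen.ext {ξ : V} (h : S.Gen ξ) {b b' : ↥S.W0 → ℂ} (he : S.EE ξ b = S.EE ξ b') : b = b' := by
  have hinj : Function.Injective fun w : ↥S.W0 => S.chr (S.lin w ξ) := by
    intro w w' hww
    by_contra hne
    obtain ⟨α, hα, h1⟩ := h w w' hne
    exact h1 (DFunLike.congr_fun hww (Multiplicative.ofAdd (⟨α, S.root_PG hα⟩ : ↥S.PG)))
  have hli := (linearIndependent_monoidHom (Multiplicative ↥S.PG) ℂ).comp _ hinj
  rw [Fintype.linearIndependent_iff] at hli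
  funext w
  rw [← sub_eq_zero]
  refine hli (fun w => b w - b' w) ?_ w
  funext x
  have h2 := congrFun he (⟨(Multiplicative.toAdd x).1, (Multiplicative.toAdd x).2⟩ : ↥S.Plat)
  simp only [EE, Finset.sum_apply, Pi.smul_apply, smul_eq_mul] at h2
  simp only [Finset.sum_apply, Pi.smul_apply, smul_eq_mul, Function.comp_apply, sub_mul,
    Finset.sum_sub_distrib, Pi.zero_apply]
  rw [sub_eq_zero]
  exact h2

variable {S} in
lemma Gen.eig {TW : Equiv.Perm V → (↥S.Plat → ℂ) → (↥S.Plat → ℂ)} (hTW : S.IsTW TW) {ξ : V}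
    (hg : S.Gen ξ) (h : S.Reg ξ) (i : Fin S.n) (w : ↥S.W0) :
    S.Tt i.succ ξ (S.bphi ξ) w = S.t (S.alpha i.succ) * S.bphi ξ w := by
  have h1 := phi_eig hTW h i
  rw [phi_EE hTW h, S.TL_EE _ h, ← EE_smul] at h1
  exact congrFun (hg.ext h1) w

lemma exists_dir : ∃ ζ : V, ∀ w w' : ↥S.W0, w ≠ w' → S.lin w ζ ≠ S.lin w' ζ := by
  by_contra hc
  push Not at hc
  let ι := {p : ↥S.W0 × ↥S.W0 // p.1 ≠ p.2}
  obtain ⟨i, hi⟩ := Subspace.exists_eq_top_of_iUnion_eq_univ (k := ℝ) (E := V)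
    (p := fun i : ι => LinearMap.ker (S.lin i.1.1 - S.lin i.1.2)) (by
      rw [Set.eq_univ_iff_forall]
      intro ζ
      obtain ⟨w, w', hne, he⟩ := hc ζ
      rw [Set.mem_iUnion]
      exact ⟨⟨(w, w'), hne⟩, by simp [he]⟩)
  apply i.2
  apply S.lin_ext
  intro α _
  have : α ∈ LinearMap.ker (S.lin i.1.1 - S.lin i.1.2) := hi ▸ Submodule.mem_top
  rw [LinearMap.mem_ker, LinearMap.sub_apply, sub_eq_zero] at this
  exact this

lemma ev_ne (a b d e : ℝ) (h : d ≠ e) : ∀ᶠ ε in nhdsWithin (0 : ℝ) {0}ᶜ,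
    Complex.exp (Complex.I * ((a + ε * d : ℝ) : ℂ)) ≠ Complex.exp (Complex.I * ((b + ε * e : ℝ) : ℂ)) := by
  have hd : HasDerivAt (fun ε : ℝ => Complex.exp (Complex.I * (((a - b) + ε * (d - e) : ℝ) : ℂ)))
      (Complex.exp (Complex.I * (((a - b) + 0 * (d - e) : ℝ) : ℂ)) * (Complex.I * ((d - e : ℝ) : ℂ))) 0 := by
    have h1 : HasDerivAt (fun ε : ℝ => (a - b) + ε * (d - e)) (d - e) 0 := by
      simpa using ((hasDerivAt_id (0:ℝ)).mul_const (d - e)).const_add (a - b)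
    exact (h1.ofReal_comp.const_mul Complex.I).cexp
  have hne : Complex.exp (Complex.I * (((a - b) + 0 * (d - e) : ℝ) : ℂ)) *
      (Complex.I * ((d - e : ℝ) : ℂ)) ≠ 0 :=
    mul_ne_zero (Complex.exp_ne_zero _) (mul_ne_zero Complex.I_ne_zero
      (by exact_mod_cast sub_ne_zero.mpr h))
  filter_upwards [hd.eventually_ne hne (c := 1)] with ε hε he
  apply hε
  have : Complex.I * (((a - b) + ε * (d - e) : ℝ) : ℂ) = Complex.I * ((a + ε * d : ℝ) : ℂ) -
      Complex.I * ((b + ε * e : ℝ) : ℂ) := by push_cast; ring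
  rw [this, Complex.exp_sub, he, div_self (Complex.exp_ne_zero _)]

lemma ev_gen (ξ : V) {ζ : V} (hζ : ∀ w w' : ↥S.W0, w ≠ w' → S.lin w ζ ≠ S.lin w' ζ) :
    ∀ᶠ ε in nhdsWithin (0 : ℝ) {0}ᶜ, S.Gen (ξ + ε • ζ) := by
  have h1 : ∀ w w' : ↥S.W0, ∀ᶠ ε in nhdsWithin (0 : ℝ) {0}ᶜ, w ≠ w' → ∃ α ∈ S.R0,
      Complex.exp (Complex.I * (⟪α, S.lin w (ξ + ε • ζ)⟫ : ℝ)) ≠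
        Complex.exp (Complex.I * (⟪α, S.lin w' (ξ + ε • ζ)⟫ : ℝ)) := by
    intro w w'
    by_cases hw : w = w'
    · exact Filter.Eventually.of_forall fun _ h => absurd hw h
    have : ∃ α ∈ S.R0, ⟪α, S.lin w ζ⟫ ≠ ⟪α, S.lin w' ζ⟫ := by
      by_contra hc
      push Not at hc
      apply hζ w w' hw
      have : (innerₗ V).flip (S.lin w ζ) = (innerₗ V).flip (S.lin w' ζ) := by
        apply LinearMap.ext_on (s := (S.R0 : Set V)) S.span_top
        intro α hα
        exact hc α hα
      refine ext_inner_left ℝ fun v => ?_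
      exact LinearMap.congr_fun this v
    obtain ⟨α, hα, hd⟩ := this
    filter_upwards [ev_ne ⟪α, S.lin w ξ⟫ ⟪α, S.lin w' ξ⟫ _ _ hd] with ε hε _
    refine ⟨α, hα, ?_⟩
    simpa only [map_add, map_smul, inner_add_right, real_inner_smul_right] using hε
  have h2 := Filter.eventually_all.mpr fun w => Filter.eventually_all.mpr (h1 w)
  filter_upwards [h2] with ε hε w w' using hε w w'

lemma ev_reg {ξ : V} (h : S.Reg ξ) (ζ : V) :
    ∀ᶠ ε in nhds (0 : ℝ), S.Reg (ξ + ε • ζ) := by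
  have h1 : ∀ α ∈ S.R0, ∀ᶠ ε in nhds (0 : ℝ),
      Complex.exp (Complex.I * (⟪ξ + ε • ζ, α⟫ : ℝ)) ≠ 1 := by
    intro α hα
    have hc : Continuous fun ε : ℝ => Complex.exp (Complex.I * (⟪ξ + ε • ζ, α⟫ : ℝ)) := by
      fun_prop
    apply hc.continuousAt.eventually_ne
    simpa using exp_ne_one (h α hα)
  have h2 := (Filter.eventually_all_finset S.R0).mpr h1
  filter_upwards [h2] with ε hε α hα k hk
  exact hε α hα (exp_one_of hk)

lemma Tt_cont (j : Fin (S.n + 1)) {ξ ζ : V} (h : S.Reg ξ) {b : ℝ → ↥S.W0 → ℂ}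
    (hb : ∀ w, ContinuousAt (fun ε => b ε w) 0) (w : ↥S.W0) :
    ContinuousAt (fun ε : ℝ => S.Tt j (ξ + ε • ζ) (b ε) w) 0 := by
  have hl : ∀ w, Continuous fun ε : ℝ => S.lin w (ξ + ε • ζ) := fun w => by
    simp only [map_add, map_smul]; fun_prop
  have hz : ∀ w, Continuous fun ε : ℝ => S.zz j (S.lin w (ξ + ε • ζ)) := fun w => by
    have := hl w
    unfold zz; fun_prop
  have hk : ∀ w, Continuous fun ε : ℝ => S.kz j (S.lin w (ξ + ε • ζ)) := fun w => by
    have := hl w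
    unfold kz; fun_prop
  have hne : ∀ w, 1 - S.zz j (S.lin w (ξ + (0:ℝ) • ζ)) ≠ 0 := fun w => by
    rw [zero_smul, add_zero]
    exact sub_ne_zero.mpr (S.zz_ne_one j (h.lin w)).symm
  have hB : ∀ w, ContinuousAt (fun ε : ℝ => S.Bj j (S.lin w (ξ + ε • ζ))) 0 := fun w => by
    unfold Bj
    exact ContinuousAt.div (continuous_const.mul (hz w)).continuousAt
      (continuous_const.sub (hz w)).continuousAt (hne w)
  have hA : ∀ w, ContinuousAt (fun ε : ℝ => S.Aj j (S.lin w (ξ + ε • ζ))) 0 := fun w => by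
    unfold Aj
    exact ContinuousAt.div ((hk w).mul (continuous_const.sub (hz w))).continuousAt
      (continuous_const.sub (hz w)).continuousAt
      (hne w)
  unfold Tt
  exact ((hb _).mul (hB _)).add ((hb _).mul (hA _))

lemma bw_cont {ξ ζ : V} (h : S.Reg ξ) (l : List (Fin (S.n + 1))) (w : ↥S.W0) :
    ContinuousAt (fun ε : ℝ => S.bw (ξ + ε • ζ) l w) 0 := by
  induction l generalizing w with
  | nil => exact continuousAt_const
  | cons j l ih => exact S.Tt_cont j h ih w

variable {S} in
/-- The coefficient form of the eigenvalue equations at a regular point. -/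
lemma reg_eig {TW : Equiv.Perm V → (↥S.Plat → ℂ) → (↥S.Plat → ℂ)} (hTW : S.IsTW TW) {ξ : V}
    (h : S.Reg ξ) (i : Fin S.n) (w : ↥S.W0) :
    S.Tt i.succ ξ (S.bphi ξ) w = S.t (S.alpha i.succ) * S.bphi ξ w := by
  obtain ⟨ζ, hζ⟩ := S.exists_dir
  have hb : ∀ w, ContinuousAt (fun ε : ℝ => S.bphi (ξ + ε • ζ) w) 0 := by
    intro w
    unfold bphi
    exact tendsto_finsetSum _ fun v _ => S.bw_cont h (S.rword v) w
  have c1 := (S.Tt_cont i.succ (ζ := ζ) h hb w).tendsto.mono_left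
    (nhdsWithin_le_nhds (s := {0}ᶜ))
  have c2 := ((continuousAt_const (y := (S.t (S.alpha i.succ) : ℂ))).mul (hb w)).tendsto.mono_left
    (nhdsWithin_le_nhds (s := {0}ᶜ))
  have he : (fun ε : ℝ => S.Tt i.succ (ξ + ε • ζ) (S.bphi (ξ + ε • ζ)) w) =ᶠ[nhdsWithin 0 {0}ᶜ]
      fun ε : ℝ => (S.t (S.alpha i.succ) : ℂ) * S.bphi (ξ + ε • ζ) w := by
    filter_upwards [S.ev_gen ξ hζ, (S.ev_reg h ζ).filter_mono nhdsWithin_le_nhds] with ε hg hr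
    exact hg.eig hTW hr i w
  have := tendsto_nhds_unique_of_eventuallyEq c1 c2 he
  simpa using this

end

section

variable (S : Setup V)

/-! ### The c-function -/

lemma one_sub_ne {t x : ℝ} (ht : |t| < 1) :
    1 - (t : ℂ) * Complex.exp (Complex.I * (x : ℝ)) ≠ 0 := by
  intro hc
  have h1 : (t : ℂ) * Complex.exp (Complex.I * (x : ℝ)) = 1 := (sub_eq_zero.mp hc).symm
  have h2 := congrArg norm h1
  rw [norm_mul, mul_comm Complex.I, Complex.norm_exp_ofReal_mul_I, Complex.norm_real,
    Real.norm_eq_abs, norm_one, mul_one] at h2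
  linarith

/-- A factor of the c-function. -/
def cc (η α : V) : ℂ := (1 - (S.t α : ℂ) * Complex.exp (-(Complex.I * (⟪η, α⟫ : ℂ)))) /
      (1 - Complex.exp (-(Complex.I * (⟪η, α⟫ : ℂ))))

lemma Cfun_eq (η : V) : S.Cfun η = ∏ α ∈ S.Rpos, S.cc η α := rfl

lemma exp_neg_ne {η : V} (h : S.Reg η) {α : V} (hα : α ∈ S.R0) :
    1 - Complex.exp (-(Complex.I * (⟪η, α⟫ : ℂ))) ≠ 0 := by
  have h1 := exp_ne_one (h _ (S.neg_mem hα))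
  rw [inner_neg_right] at h1
  push_cast at h1
  rw [mul_neg] at h1
  exact sub_ne_zero.mpr h1.symm

lemma num_ne (η : V) {α : V} (hα : α ∈ S.R0) :
    1 - (S.t α : ℂ) * Complex.exp (-(Complex.I * (⟪η, α⟫ : ℂ))) ≠ 0 := by
  have h1 := one_sub_ne (x := -⟪η, α⟫) (S.t_bound α hα)
  push_cast at h1
  rwa [mul_neg] at h1

lemma Cfun_ne {η : V} (h : S.Reg η) : S.Cfun η ≠ 0 := by
  rw [Cfun_eq, Finset.prod_ne_zero_iff]
  intro α hα
  exact div_ne_zero (S.num_ne η (S.pos_R hα)) (S.exp_neg_ne h (S.pos_R hα))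

/-- The phase `e^{-i v_α(⟨η, α⟩)}`. -/
def ph (η α : V) : ℂ := Complex.exp (-(Complex.I * (vv (S.t α) ⟪η, α⟫ : ℝ)))

lemma ph_eq (η : V) {α : V} (hα : α ∈ S.R0) :
    S.ph η α * (1 - (S.t α : ℂ) * Complex.exp (-(Complex.I * (⟪η, α⟫ : ℂ)))) =
      Complex.exp (-(Complex.I * (⟪η, α⟫ : ℂ))) - S.t α := by
  have := exp_vv (S.t_bound α hα) (-⟪η, α⟫)
  rw [vv_neg] at this
  push_cast at this
  simp only [mul_neg] at this
  exact this

lemma cc_neg {η : V} (h : S.Reg η) {α : V} (hα : α ∈ S.R0) :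
    S.cc η (-α) = -S.ph η α * S.cc η α := by
  have h1 := S.exp_neg_ne h hα
  have h2 := S.ph_eq η hα
  have h3 := S.exp_neg_ne h (S.neg_mem hα)
  rw [inner_neg_right] at h3
  push_cast at h3
  rw [mul_neg, neg_neg] at h3
  have h4 : Complex.exp (Complex.I * (⟪η, α⟫ : ℂ)) *
      Complex.exp (-(Complex.I * (⟪η, α⟫ : ℂ))) = 1 := by
    rw [← Complex.exp_add, add_neg_cancel, Complex.exp_zero]
  rw [cc, cc, S.t_neg hα, inner_neg_right]
  push_cast
  rw [mul_neg, neg_neg, ← mul_div_assoc, neg_mul, h2, div_eq_div_iff h3 h1]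
  set E := Complex.exp (Complex.I * (⟪η, α⟫ : ℂ))
  set F := Complex.exp (-(Complex.I * (⟪η, α⟫ : ℂ)))
  linear_combination ((S.t α : ℂ) - 1) * h4

/-- Positive roots made negative by `s_β`. -/
def NN (β : V) : Finset V := S.Rpos.filter fun α => sr β α ∉ S.Rpos

lemma Cfun_sr {η : V} (h : S.Reg η) {β : V} (hβ : β ∈ S.R0) :
    S.Cfun (sr β η) = (∏ α ∈ S.NN β, -S.ph η α) * S.Cfun η := by
  have h0 : S.Cfun (sr β η) = ∏ α ∈ S.Rpos, S.cc η (sr β α) := by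
    rw [Cfun_eq]
    refine Finset.prod_congr rfl fun α hα => ?_
    rw [cc, cc, sr_inner_left, S.t_sr hβ (S.pos_R hα)]
  have h1 : ∏ α ∈ S.NN β, S.cc η (sr β α) = ∏ α ∈ S.NN β, S.cc η (-α) := by
    have hm : ∀ α ∈ S.NN β, -sr β α ∈ S.NN β := by
      intro α hα
      rw [NN, Finset.mem_filter] at hα ⊢
      refine ⟨(S.pos_or_neg (S.sr_mem hβ (S.pos_R hα.1))).resolve_left hα.2, ?_⟩
      rw [map_neg, sr_sr]
      exact S.not_neg_pos hα.1
    refine Finset.prod_nbij' (fun α => -sr β α) (fun α => -sr β α) hm hm ?_ ?_ ?_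
    · intro α _; rw [map_neg, sr_sr, neg_neg]
    · intro α _; rw [map_neg, sr_sr, neg_neg]
    · intro α _; rw [neg_neg]
  have h2 : ∏ α ∈ S.Rpos.filter (fun α => ¬ sr β α ∉ S.Rpos), S.cc η (sr β α) =
      ∏ α ∈ S.Rpos.filter (fun α => ¬ sr β α ∉ S.Rpos), S.cc η α := by
    have hm : ∀ α ∈ S.Rpos.filter (fun α => ¬ sr β α ∉ S.Rpos),
        sr β α ∈ S.Rpos.filter (fun α => ¬ sr β α ∉ S.Rpos) := by
      intro α hα
      rw [Finset.mem_filter, not_not] at hα ⊢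
      exact ⟨hα.2, by rw [sr_sr]; exact hα.1⟩
    refine Finset.prod_nbij' (fun α => sr β α) (fun α => sr β α) hm hm ?_ ?_ ?_
    · intro α _; rw [sr_sr]
    · intro α _; rw [sr_sr]
    · intro α _; rfl
  have h3 : ∏ α ∈ S.NN β, S.cc η (-α) = (∏ α ∈ S.NN β, -S.ph η α) * ∏ α ∈ S.NN β, S.cc η α := by
    rw [← Finset.prod_mul_distrib]
    exact Finset.prod_congr rfl fun α hα => S.cc_neg h (S.pos_R (Finset.mem_filter.mp hα).1)
  rw [h0, ← Finset.prod_filter_mul_prod_filter_not S.Rpos (fun α => sr β α ∉ S.Rpos), h2]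
  rw [NN] at h1 h3
  rw [h1, h3, mul_assoc, Finset.prod_filter_mul_prod_filter_not, NN, Cfun_eq]

lemma NN_simple (j : Fin S.n) : S.NN (S.simple j) = {S.simple j} := by
  ext α
  rw [NN, Finset.mem_filter, Finset.mem_singleton]
  constructor
  · rintro ⟨h1, h2⟩
    by_contra hne
    exact h2 (S.simple_perm h1 hne)
  · rintro rfl
    refine ⟨S.simple_mem j, ?_⟩
    rw [sr_self (S.ne_zero (S.simple_R j))]
    exact S.not_neg_pos (S.simple_mem j)

lemma zz_succ (j : Fin S.n) (η : V) :
    S.zz j.succ η = Complex.exp (-(Complex.I * (⟪η, S.simple j⟫ : ℂ))) := by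
  rw [zz, alpha_succ, real_inner_comm]

lemma Cfun_simple {η : V} (h : S.Reg η) (j : Fin S.n) :
    S.Cfun η * (S.t (S.alpha j.succ) - S.zz j.succ η) =
      S.Cfun (sr (S.alpha j.succ) η) * (1 - S.t (S.alpha j.succ) * S.zz j.succ η) := by
  rw [zz_succ, alpha_succ, S.Cfun_sr h (S.simple_R j), NN_simple, Finset.prod_singleton]
  have := S.ph_eq η (S.simple_R j)
  linear_combination S.Cfun η * this

lemma kz_succ (j : Fin S.n) (η : V) : S.kz j.succ η = 1 := by
  simp [kz, kconst_succ]

variable {S} in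
lemma bphi_eq {TW : Equiv.Perm V → (↥S.Plat → ℂ) → (↥S.Plat → ℂ)} (hTW : S.IsTW TW) {ξ : V}
    (h : S.Reg ξ) (w : ↥S.W0) :
    S.bphi ξ w * S.Cfun ξ = S.bphi ξ 1 * S.Cfun (S.lin w ξ) := by
  have step : ∀ (i : Fin S.n) (w : ↥S.W0),
      S.bphi ξ w * S.Cfun ξ = S.bphi ξ 1 * S.Cfun (S.lin w ξ) →
      S.bphi ξ (S.sg i.succ * w) * S.Cfun ξ = S.bphi ξ 1 * S.Cfun (S.lin (S.sg i.succ * w) ξ) := by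
    intro i w hw
    have h1 := (S.Tt_eig i.succ h (S.bphi ξ) w).mp (reg_eig hTW h i w)
    rw [kz_succ, inv_one, one_mul] at h1
    have h2 := S.Cfun_simple (h.lin w) i
    rw [lin_mul, lin_sg]
    have hne : 1 - (S.t (S.alpha i.succ) : ℂ) * S.zz i.succ (S.lin w ξ) ≠ 0 := by
      rw [zz_succ, alpha_succ]
      exact S.num_ne _ (S.simple_R i)
    apply mul_right_cancel₀ hne
    linear_combination (-S.Cfun ξ) * h1 + (S.t (S.alpha i.succ) - S.zz i.succ (S.lin w ξ)) * hw +
      S.bphi ξ 1 * h2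
  have key : ∀ w, w ∈ Subgroup.closure (Set.range fun i : Fin S.n => S.sgen i.succ) →
      ∀ hw : w ∈ S.W0, S.bphi ξ ⟨w, hw⟩ * S.Cfun ξ = S.bphi ξ 1 * S.Cfun (S.lin ⟨w, hw⟩ ξ) := by
    have aux : ∀ (i : Fin S.n) (y : Equiv.Perm V), (∀ hw : y ∈ S.W0,
        S.bphi ξ ⟨y, hw⟩ * S.Cfun ξ = S.bphi ξ 1 * S.Cfun (S.lin ⟨y, hw⟩ ξ)) →
        ∀ hw : S.sgen i.succ * y ∈ S.W0, S.bphi ξ ⟨S.sgen i.succ * y, hw⟩ * S.Cfun ξ =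
          S.bphi ξ 1 * S.Cfun (S.lin ⟨S.sgen i.succ * y, hw⟩ ξ) := by
      intro i y hy hw
      have hs : S.sgen i.succ ∈ S.W0 := by
        rw [sgen_succ]; exact Subgroup.subset_closure ⟨_, S.simple_R i, rfl⟩
      have hy' : y ∈ S.W0 := by
        have := S.W0.mul_mem hs hw
        rwa [← mul_assoc, sgen_mul, one_mul] at this
      have he : (⟨S.sgen i.succ * y, hw⟩ : ↥S.W0) = S.sg i.succ * ⟨y, hy'⟩ :=
        Subtype.ext (S.sg_succ i ⟨y, hy'⟩).symm
      rw [he]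
      exact step i _ (hy hy')
    intro w hw
    refine Subgroup.closure_induction_left (p := fun w _ => ∀ hw : w ∈ S.W0,
      S.bphi ξ ⟨w, hw⟩ * S.Cfun ξ = S.bphi ξ 1 * S.Cfun (S.lin ⟨w, hw⟩ ξ)) ?_ ?_ ?_ hw
    · intro h1
      have : (⟨1, h1⟩ : ↥S.W0) = 1 := rfl
      rw [this, lin_one]
    · rintro _ ⟨i, rfl⟩ y _ hy
      exact aux i y hy
    · rintro _ ⟨i, rfl⟩ y _ hy
      simp only [sgen_inv]
      exact aux i y hy
  exact key w.1 (S.W0_le w.2) w.2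

/-! ### The affine reflection -/

lemma theta_pair {α : V} (hα : α ∈ S.Rpos) : ⟪S.theta, S.hat α⟫ =
    (if α ∈ S.NN S.theta then 1 else 0) + (if α = S.theta then 1 else 0) := by
  by_cases he : α = S.theta
  · subst he
    have : S.theta ∈ S.NN S.theta := by
      rw [NN, Finset.mem_filter, sr_self (S.ne_zero S.theta_R)]
      exact ⟨S.theta_pos, S.not_neg_pos S.theta_pos⟩
    rw [theta_two, if_pos this, if_pos rfl]; norm_num
  · obtain ⟨k, hk⟩ := S.theta_int (S.pos_R hα)
    have h1 := S.theta_le_one (S.pos_R hα) he hk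
    have h0 : 0 ≤ ⟪S.theta, S.hat α⟫ :=
      (S.hat_nonneg (S.pos_R hα) _).mpr (S.dom_nonneg S.theta_dom hα)
    have h0' : 0 ≤ k := by rw [hk] at h0; exact_mod_cast h0
    rw [if_neg he, add_zero]
    have hcase : k = 0 ∨ k = 1 := by omega
    rcases hcase with rfl | rfl
    · rw [if_neg, hk]
      · simp
      rw [NN, Finset.mem_filter]
      rintro ⟨_, h2⟩
      apply h2
      have hz : ⟪S.theta, α⟫ = 0 := (S.hat_zero (S.pos_R hα) _).mp (by rw [hk]; simp)
      rw [sr_apply, inner_coroot, real_inner_comm, hz]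
      simpa using hα
    · rw [if_pos, hk]
      · simp
      rw [NN, Finset.mem_filter]
      refine ⟨hα, fun h2 => ?_⟩
      have hp : 0 < ⟪S.theta, α⟫ := (S.hat_pos (S.pos_R hα) _).mp (by rw [hk]; simp)
      have h3 := S.dom_nonneg S.theta_dom h2
      rw [← sr_inner_left, sr_self (S.ne_zero S.theta_R), inner_neg_left] at h3
      linarith

lemma theta_sum (f : V → ℝ) : ∑ α ∈ S.Rpos, f α * ⟪S.hat α, S.theta⟫ =
    ∑ α ∈ S.NN S.theta, f α + f S.theta := by
  have h1 : ∀ α ∈ S.Rpos, f α * ⟪S.hat α, S.theta⟫ =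
      (if α ∈ S.NN S.theta then f α else 0) + (if α = S.theta then f α else 0) := by
    intro α hα
    rw [real_inner_comm, S.theta_pair hα, mul_add, mul_ite, mul_ite, mul_one, mul_zero]
  rw [Finset.sum_congr rfl h1, Finset.sum_add_distrib, Finset.sum_ite_eq' S.Rpos,
    if_pos S.theta_pos, Finset.sum_ite_mem,
    Finset.inter_eq_right.mpr (show S.NN S.theta ⊆ S.Rpos from Finset.filter_subset _ _)]

lemma NN_parity : ((-1 : ℂ)) ^ (S.NN S.theta).card = -1 := by
  have h1 := S.theta_sum fun _ => 1
  obtain ⟨k, hk⟩ := S.rhoHat_Phat _ S.theta_R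
  rw [coroot_hat_theta, rhoHat, real_inner_smul_left, sum_inner] at hk
  simp only [one_mul, Finset.sum_const, nsmul_eq_mul, mul_one] at h1
  rw [h1] at hk
  have h2 : ((S.NN S.theta).card : ℤ) + 1 = 2 * k := by
    have : ((S.NN S.theta).card : ℝ) + 1 = 2 * k := by linarith
    exact_mod_cast this
  have h3 : Odd (S.NN S.theta).card := by
    rw [← Nat.not_even_iff_odd]
    rintro ⟨m, hm⟩
    omega
  exact h3.neg_one_pow

lemma FF_lin (w : ↥S.W0) (ξ : V) : S.FF (S.lin w ξ) = S.lin w (S.FF ξ) := by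
  have h1 : S.FF (S.lin w ξ) + S.FF (S.lin w ξ) = S.lin w (S.FF ξ) + S.lin w (S.FF ξ) := by
    rw [← FF_R0, ← map_add, ← FF_R0, map_sum]
    refine Finset.sum_nbij' (fun α => S.lin w⁻¹ α) (fun α => S.lin w α) ?_ ?_ ?_ ?_ ?_
    · intro α h; exact S.lin_R _ h
    · intro α h; exact S.lin_R _ h
    · intro α _; exact S.lin_inv' w α
    · intro α _; exact S.lin_inv w α
    · intro α h
      rw [map_smul, ← lin_hat, lin_inv', S.lin_t _ h, lin_inner_left]
  have h2 : (2 : ℝ) • S.FF (S.lin w ξ) = (2 : ℝ) • S.lin w (S.FF ξ) := by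
    rw [two_smul, two_smul, h1]
  exact smul_right_injective V (two_ne_zero) h2

variable {S} in
lemma crit_lin {xi : V → V} (hxi : S.IsMinimizer xi) {μ : V} (hμ : μ ∈ S.Phat) (w : ↥S.W0) :
    ∃ k : ℤ, S.c * ⟪S.lin w (xi μ), S.theta⟫ + ⟪S.FF (S.lin w (xi μ)), S.theta⟫ =
      k * (2 * Real.pi) := by
  have h1 := S.crit hxi hμ (S.lin w⁻¹ S.theta)
  have hR := S.lin_R w⁻¹ S.theta_R
  have hm : coroot (S.hat (S.lin w⁻¹ S.theta)) = S.lin w⁻¹ S.theta := by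
    rw [S.coroot_hat hR, m, lin_hat, lin_inner, theta_two]; norm_num
  obtain ⟨a, ha⟩ := S.rhoHat_Phat _ hR
  obtain ⟨b, hb⟩ := hμ _ hR
  rw [hm] at ha hb
  refine ⟨a + b, ?_⟩
  rw [FF_lin, lin_inner_left, lin_inner_left, h1, inner_add_left, ha, hb]
  push_cast; ring

variable {S} in
lemma bethe {xi : V → V} (hxi : S.IsMinimizer xi) {μ : V} (hμ : μ ∈ S.Phatc) (w : ↥S.W0) :
    S.Cfun (S.lin w (xi μ)) * (S.t (S.alpha 0) - S.zz 0 (S.lin w (xi μ))) =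
      S.Cfun (sr (S.alpha 0) (S.lin w (xi μ))) * ((S.kz 0 (S.lin w (xi μ)))⁻¹ *
        (1 - S.t (S.alpha 0) * S.zz 0 (S.lin w (xi μ)))) := by
  obtain ⟨k, hk⟩ := crit_lin hxi hμ.1 w
  have hreg := (S.crit_reg hxi hμ).lin w
  set η := S.lin w (xi μ) with hη
  have hFF : ⟪S.FF η, S.theta⟫ = ∑ α ∈ S.NN S.theta, vv (S.t α) ⟪η, α⟫ +
      vv (S.t S.theta) ⟪η, S.theta⟫ := by
    rw [FF, sum_inner, ← theta_sum S (fun α => vv (S.t α) ⟪η, α⟫)]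
    simp only [real_inner_smul_left]
  rw [hFF] at hk
  have hexp := exp_one_of hk
  have hsr : sr (S.alpha 0) η = sr S.theta η := by rw [alpha_zero, sr_neg]
  have ht : S.t (S.alpha 0) = S.t S.theta := by rw [alpha_zero, S.t_neg S.theta_R]
  have hz : S.zz 0 η = Complex.exp (Complex.I * (⟪η, S.theta⟫ : ℂ)) := by
    rw [zz, alpha_zero, inner_neg_left, real_inner_comm]; push_cast; congr 1; ring
  have hkz : (S.kz 0 η)⁻¹ = Complex.exp (-(Complex.I * ((S.c * ⟪η, S.theta⟫ : ℝ) : ℂ))) := by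
    rw [kz, alpha_zero, inner_neg_left, real_inner_comm, kconst_zero, ← Complex.exp_neg]
    push_cast; congr 1; ring
  have hprod : ∏ α ∈ S.NN S.theta, -S.ph η α =
      -Complex.exp (-(Complex.I * ((∑ α ∈ S.NN S.theta, vv (S.t α) ⟪η, α⟫ : ℝ) : ℂ))) := by
    rw [Finset.prod_neg, NN_parity, neg_one_mul]
    congr 1
    simp only [ph]
    rw [← Complex.exp_sum]
    congr 1
    push_cast
    rw [Finset.mul_sum, Finset.sum_neg_distrib]
  have hv := exp_vv (S.t_bound _ S.theta_R) ⟪η, S.theta⟫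
  have hcomb : Complex.exp (-(Complex.I * ((∑ α ∈ S.NN S.theta, vv (S.t α) ⟪η, α⟫ : ℝ) : ℂ))) *
      Complex.exp (-(Complex.I * ((S.c * ⟪η, S.theta⟫ : ℝ) : ℂ))) =
      Complex.exp (Complex.I * (vv (S.t S.theta) ⟪η, S.theta⟫ : ℝ)) := by
    rw [← Complex.exp_add, ← mul_one (Complex.exp _), ← hexp, ← Complex.exp_add]
    congr 1
    push_cast; ring
  rw [hsr, ht, hz, hkz, S.Cfun_sr hreg S.theta_R, hprod]
  have hv' := hv
  rw [← hcomb] at hv'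
  linear_combination S.Cfun η * hv'

variable {S} in
lemma main_eig {TW : Equiv.Perm V → (↥S.Plat → ℂ) → (↥S.Plat → ℂ)} (hTW : S.IsTW TW)
    {xi : V → V} (hxi : S.IsMinimizer xi) {μ : V} (hμ : μ ∈ S.Phatc) (j : Fin (S.n + 1)) :
    S.TL j (S.phiW TW (xi μ)) = (S.t (S.alpha j) : ℂ) • S.phiW TW (xi μ) := by
  have hreg := S.crit_reg hxi hμ
  refine Fin.cases ?_ (fun i => phi_eig hTW hreg i) j
  rw [phi_EE hTW hreg, S.TL_EE _ hreg, ← EE_smul]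
  congr 1
  funext w
  rw [S.Tt_eig 0 hreg]
  apply mul_right_cancel₀ (S.Cfun_ne hreg)
  have h1 := bphi_eq hTW hreg w
  have h2 := bphi_eq hTW hreg (S.sg 0 * w)
  rw [lin_mul, lin_sg] at h2
  have h3 := bethe hxi hμ w
  linear_combination (S.t (S.alpha 0) - S.zz 0 (S.lin w (xi μ))) * h1 + S.bphi (xi μ) 1 * h3 -
    ((S.kz 0 (S.lin w (xi μ)))⁻¹ * (1 - S.t (S.alpha 0) * S.zz 0 (S.lin w (xi μ)))) * h2

theorem final (htne : ∀ α ∈ S.R0, S.t α ≠ 0)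
    (wmin : V → Equiv.Perm V) (hwmin : S.IsShortest wmin)
    (TW : Equiv.Perm V → (↥S.Plat → ℂ) → (↥S.Plat → ℂ)) (hTW : S.IsTW TW)
    (xi : V → V) (hxi : S.IsMinimizer xi) (μ : V) (hμ : μ ∈ S.Phatc) :
    S.Winv (S.PhiA wmin TW (xi μ)) ∧
    (∀ w ∈ S.W0, ∀ x : ↥S.Plat,
        S.ev (S.PhiA wmin TW (xi μ)) (w⁻¹ x.1) = S.PhiA wmin TW (xi μ) x) ∧
    (∀ q ∈ S.Qhatvee, ∀ x : ↥S.Plat,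
        S.ev (S.PhiA wmin TW (xi μ)) (x.1 + (S.c : ℝ) • q)
          = S.PhiA wmin TW (xi μ) x) := by
  have hW : S.Winv (S.PhiA wmin TW (xi μ)) := JJ_inv htne hwmin hTW (main_eig hTW hxi hμ)
  refine ⟨hW, fun w hw => hW w (S.W0_le_W hw), fun q hq x => ?_⟩
  have h1 := hW _ (S.W.inv_mem (S.transl_W q hq)) x
  rw [inv_inv] at h1
  exact h1

end

end Setup


/-- for every `μ ∈ P̂_c` the affine Macdonald spherical function
`Φ_{ξ_μ} = 𝒥 φ_{ξ_μ}` is invariant under the full affine Weyl group; equivalently it is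
`W₀`-invariant and periodic with respect to translations over `c Q̂^∨`. -/
theorem statement8 (S : Setup V) (htne : ∀ α ∈ S.R0, S.t α ≠ 0)
    (wmin : V → Equiv.Perm V) (hwmin : S.IsShortest wmin)
    (TW : Equiv.Perm V → (↥S.Plat → ℂ) → (↥S.Plat → ℂ)) (hTW : S.IsTW TW)
    (xi : V → V) (hxi : S.IsMinimizer xi) (μ : V) (hμ : μ ∈ S.Phatc) :
    S.Winv (S.PhiA wmin TW (xi μ)) ∧
    (∀ w ∈ S.W0, ∀ x : ↥S.Plat,
        S.ev (S.PhiA wmin TW (xi μ)) (w⁻¹ x.1) = S.PhiA wmin TW (xi μ) x) ∧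
    (∀ q ∈ S.Qhatvee, ∀ x : ↥S.Plat,
        S.ev (S.PhiA wmin TW (xi μ)) (x.1 + (S.c : ℝ) • q)
          = S.PhiA wmin TW (xi μ) x) := by
  exact S.final htne wmin hwmin TW hTW xi hxi μ hμ

end AffinePieri
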